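/- Let X be a Lévy process with positive sojourn time A_t, let q > 0 and let E^{(q)} ~ Exp(q) be independent of X. Then the Laplace transform of A_{E^{(q)}} satisfies, for all λ > 0, E[exp(−λ A_{E^{(q)}})] = exp( − ∫_0^∞ e^{−qt} t^{−1} P(X_t > 0)(1 − e^{−λ t}) dt ); in particular A_{E^{(q)}} is infinitely divisible with Lévy measure e^{−qt} t^{−1} P(X_t > 0) dt on (0,∞). -/

import Mathlib

open MeasureTheory ProbabilityTheory Real Set Filter

noncomputable section

variable {Ω : Type*} [MeasurableSpace Ω]

/-- The positive sojourn time of a process `X` up to time `t`: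
`A_t := ∫_0^t 1{X_s > 0} ds`. -/
def sojourn (X : ℝ → Ω → ℝ) (t : ℝ) (ω : Ω) : ℝ :=
  ∫ s in (0:ℝ)..t, (if 0 < X s ω then (1:ℝ) else 0)

/-- A real-valued Lévy process issued from the origin: càdlàg paths a.s.,
`X 0 = 0` a.s., stationary increments, and increments independent of the past. -/
structure IsLevyProcess (P : Measure Ω) (X : ℝ → Ω → ℝ) : Prop where
  measurable : ∀ t, Measurable (X t)
  start : ∀ᵐ ω ∂P, X 0 ω = 0
  cadlag : ∀ᵐ ω ∂P, ∀ t : ℝ, 0 ≤ t →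
      ContinuousWithinAt (fun s => X s ω) (Set.Ici t) t ∧
      (0 < t → ∃ l : ℝ, Filter.Tendsto (fun s => X s ω) (nhdsWithin t (Set.Iio t)) (nhds l))
  stationary : ∀ s t : ℝ, 0 ≤ s → s ≤ t →
      P.map (fun ω => X t ω - X s ω) = P.map (X (t - s))
  indep : ∀ s t : ℝ, 0 ≤ s → s ≤ t → ∀ (n : ℕ) (u : Fin n → ℝ),
      (∀ i, 0 ≤ u i ∧ u i ≤ s) →
      IndepFun (fun ω => X t ω - X s ω) (fun ω (i : Fin n) => X (u i) ω) P

/-- `n`-fold additive convolution power of a measure on `ℝ`. -/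
def convNPow (ν : Measure ℝ) : ℕ → Measure ℝ
  | 0 => Measure.dirac 0
  | n + 1 => Measure.conv (convNPow ν n) ν

section Combinatorics

variable {ι : Type*} [DecidableEq ι]

/-- The number of orderings of `S` along which all partial sums of `x` are nonpositive, defined
through the exponential-formula recursion. -/
def negOrderings (x : ι → ℝ) (S : Finset ι) : ℝ :=
  if S = ∅ then 1 else
    (S.card : ℝ)⁻¹ * ∑ T ∈ S.powerset.attach,
      if h : T.1.Nonempty then
        (if ∑ i ∈ T.1, x i ≤ 0 then (T.1.card.factorial : ℝ) else 0) * negOrderings x (S \ T.1)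
      else 0
termination_by S.card
decreasing_by
  exact Finset.card_lt_card (Finset.sdiff_ssubset (Finset.mem_powerset.1 T.2) h)

/-- The weight `|T|!` on nonempty finsets. -/
def factWeight (T : Finset ι) : ℝ := if T.Nonempty then (T.card.factorial : ℝ) else 0

lemma negOrderings_empty (x : ι → ℝ) : negOrderings x ∅ = 1 := by
  rw [negOrderings]; simp

lemma card_mul_negOrderings (x : ι → ℝ) (S : Finset ι) :
    (S.card : ℝ) * negOrderings x S = ∑ T ∈ S.powerset,
      (if ∑ i ∈ T, x i ≤ 0 then factWeight T else 0) * negOrderings x (S \ T) := by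
  rcases S.eq_empty_or_nonempty with rfl | hS
  · simp [factWeight]
  · rw [negOrderings, if_neg hS.ne_empty, mul_inv_cancel_left₀ (by simpa using hS.ne_empty)]
    rw [← Finset.sum_attach (s := S.powerset)]
    refine Finset.sum_congr rfl fun T _ => ?_
    by_cases hT : T.1.Nonempty <;> simp [factWeight, hT]

lemma negOrderings_eq_zero (x : ι → ℝ) (S : Finset ι) (hS : 0 < ∑ i ∈ S, x i) :
    negOrderings x S = 0 := by
  induction S using Finset.strongInduction with
  | H S ih =>
    have hne : S.Nonempty := by
      by_contra h
      simp [Finset.not_nonempty_iff_eq_empty.1 h] at hS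
    have h := card_mul_negOrderings x S
    rw [Finset.sum_eq_zero] at h
    · simpa [hne.ne_empty] using h
    intro T hT
    rw [Finset.mem_powerset] at hT
    by_cases hT0 : T.Nonempty
    · split_ifs with hx
      · have := Finset.sum_sdiff (f := x) hT
        rw [ih (S \ T) (Finset.sdiff_ssubset hT hT0) (by linarith), mul_zero]
      · simp
    · simp [factWeight, hT0]

/-- The defect of `negOrderings` in the last-letter recursion. -/
def negDefect (x : ι → ℝ) (S : Finset ι) : ℝ :=
  negOrderings x S - ∑ i ∈ S, negOrderings x (S.erase i)

lemma sum_powerset_erase_comm (S : Finset ι) (F : ι → Finset ι → ℝ) :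
    ∑ i ∈ S, ∑ T ∈ (S.erase i).powerset, F i T = ∑ T ∈ S.powerset, ∑ i ∈ S \ T, F i T := by
  refine Finset.sum_comm' fun i T => ?_
  simp only [Finset.mem_powerset, Finset.mem_sdiff]
  constructor
  · rintro ⟨hi, hT⟩
    exact ⟨⟨hi, fun h => by simpa using hT h⟩, hT.trans (Finset.erase_subset _ _)⟩
  · rintro ⟨⟨hi, hiT⟩, hT⟩
    exact ⟨hi, fun j hj => Finset.mem_erase.2 ⟨fun h => hiT (h ▸ hj), hT hj⟩⟩

lemma sum_powerset_insert (S : Finset ι) (F : Finset ι → Finset ι → ℝ) :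
    ∑ T ∈ S.powerset, ∑ i ∈ S \ T, F T ((S \ T).erase i)
      = ∑ T ∈ S.powerset, ∑ i ∈ T, F (T.erase i) (S \ T) := by
  rw [Finset.sum_sigma', Finset.sum_sigma']
  refine Finset.sum_bij' (fun p _ => ⟨insert p.2 p.1, p.2⟩) (fun p _ => ⟨p.1.erase p.2, p.2⟩)
    ?_ ?_ ?_ ?_ ?_
  · rintro ⟨T, i⟩ h
    simp only [Finset.mem_sigma, Finset.mem_powerset, Finset.mem_sdiff] at h ⊢
    exact ⟨Finset.insert_subset h.2.1 h.1, Finset.mem_insert_self _ _⟩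
  · rintro ⟨T, i⟩ h
    simp only [Finset.mem_sigma, Finset.mem_powerset, Finset.mem_sdiff] at h ⊢
    exact ⟨(Finset.erase_subset _ _).trans h.1, h.1 h.2, by simp⟩
  · rintro ⟨T, i⟩ h
    simp only [Finset.mem_sigma, Finset.mem_powerset, Finset.mem_sdiff] at h
    simp [Finset.erase_insert h.2.2]
  · rintro ⟨T, i⟩ h
    simp only [Finset.mem_sigma, Finset.mem_powerset] at h
    simp [Finset.insert_erase h.2]
  · rintro ⟨T, i⟩ h
    simp only [Finset.mem_sigma, Finset.mem_powerset, Finset.mem_sdiff] at h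
    simp only [Finset.erase_insert h.2.2, Finset.sdiff_insert]

lemma factWeight_sub_sum (T : Finset ι) :
    factWeight T - ∑ i ∈ T, factWeight (T.erase i) = if T.card = 1 then 1 else 0 := by
  obtain h | h | h : T.card = 0 ∨ T.card = 1 ∨ 2 ≤ T.card := by omega
  · simp [Finset.card_eq_zero.1 h, factWeight]
  · obtain ⟨a, rfl⟩ := Finset.card_eq_one.1 h
    simp [factWeight]
  · have hT : T.Nonempty := Finset.card_pos.1 (by omega)
    have : ∀ i ∈ T, factWeight (T.erase i) = ((T.card - 1).factorial : ℝ) := by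
      intro i hi
      have hc := Finset.card_erase_of_mem hi
      rw [factWeight, if_pos (Finset.card_pos.1 (by omega)), hc]
    rw [Finset.sum_congr rfl this, factWeight, if_pos hT, if_neg (by omega), Finset.sum_const,
      nsmul_eq_mul]
    rw [← Nat.mul_factorial_pred (by omega : T.card ≠ 0)]
    push_cast; ring

lemma sum_factWeight_mul_negDefect (x : ι → ℝ) (S : Finset ι) :
    ∑ T ∈ S.powerset, factWeight T * negDefect x (S \ T)
      = ∑ i ∈ S, negOrderings x (S.erase i) := by
  have h := sum_powerset_insert S (fun T U => factWeight T * negOrderings x U)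
  simp only [negDefect, mul_sub, Finset.sum_sub_distrib, Finset.mul_sum]
  rw [h, ← Finset.sum_sub_distrib]
  have : ∀ T ∈ S.powerset, factWeight T * negOrderings x (S \ T)
      - ∑ i ∈ T, factWeight (T.erase i) * negOrderings x (S \ T)
      = if T.card = 1 then negOrderings x (S \ T) else 0 := by
    intro T _
    rw [← Finset.sum_mul, ← sub_mul, factWeight_sub_sum]
    split_ifs <;> simp
  rw [Finset.sum_congr rfl this, ← Finset.sum_filter, ← Finset.powersetCard_eq_filter,
    Finset.powersetCard_one, Finset.sum_map]
  simp [Finset.sdiff_singleton_eq_erase]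

lemma card_mul_negDefect (x : ι → ℝ) (S : Finset ι) :
    (S.card : ℝ) * negDefect x S = - ∑ T ∈ S.powerset,
      (if ∑ i ∈ T, x i ≤ 0 then 0 else factWeight T) * negDefect x (S \ T) := by
  have h1 : ∀ i ∈ S, (S.card : ℝ) * negOrderings x (S.erase i)
      = ∑ T ∈ (S.erase i).powerset, (if ∑ i ∈ T, x i ≤ 0 then factWeight T else 0)
        * negOrderings x (S.erase i \ T) + negOrderings x (S.erase i) := by
    intro i hi
    rw [← card_mul_negOrderings, ← Finset.card_erase_add_one hi]
    push_cast; ring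
  have h2 : (S.card : ℝ) * negDefect x S = ∑ T ∈ S.powerset,
      (if ∑ i ∈ T, x i ≤ 0 then factWeight T else 0) * negDefect x (S \ T)
      - ∑ i ∈ S, negOrderings x (S.erase i) := by
    rw [negDefect, mul_sub, Finset.mul_sum, Finset.sum_congr rfl h1, Finset.sum_add_distrib,
      sum_powerset_erase_comm, card_mul_negOrderings, ← sub_sub, ← Finset.sum_sub_distrib]
    congr 1
    refine Finset.sum_congr rfl fun T _ => ?_
    rw [negDefect, mul_sub, Finset.mul_sum]
    congr 1
    refine Finset.sum_congr rfl fun i _ => ?_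
    rw [Finset.erase_sdiff_comm]
  rw [h2, ← sum_factWeight_mul_negDefect, ← Finset.sum_sub_distrib, ← Finset.sum_neg_distrib]
  refine Finset.sum_congr rfl fun T _ => ?_
  split_ifs <;> ring

lemma negDefect_eq_zero (x : ι → ℝ) (S : Finset ι) (hne : S.Nonempty)
    (hS : ∑ i ∈ S, x i ≤ 0) : negDefect x S = 0 := by
  induction S using Finset.strongInduction with
  | H S ih =>
    have h := card_mul_negDefect x S
    rw [Finset.sum_eq_zero] at h
    · simpa [hne.ne_empty] using h
    intro T hT
    rw [Finset.mem_powerset] at hT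
    by_cases hT0 : T.Nonempty
    · split_ifs with hx
      · simp
      · have := Finset.sum_sdiff (f := x) hT
        have hneg : ∑ i ∈ S \ T, x i < 0 := by linarith
        rw [ih (S \ T) (Finset.sdiff_ssubset hT hT0) ?_ hneg.le, mul_zero]
        by_contra h0
        simp [Finset.not_nonempty_iff_eq_empty.1 h0] at hneg
    · simp [factWeight, hT0]

lemma negOrderings_rec (x : ι → ℝ) (S : Finset ι) (hne : S.Nonempty) :
    negOrderings x S
      = if ∑ i ∈ S, x i ≤ 0 then ∑ i ∈ S, negOrderings x (S.erase i) else 0 := by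
  split_ifs with h
  · exact sub_eq_zero.1 (negDefect_eq_zero x S hne h)
  · exact negOrderings_eq_zero x S (not_le.1 h)

lemma negOrderings_nonneg (x : ι → ℝ) (S : Finset ι) : 0 ≤ negOrderings x S := by
  induction S using Finset.strongInduction with
  | H S ih =>
    rcases S.eq_empty_or_nonempty with rfl | hne
    · simp [negOrderings_empty]
    · rw [negOrderings_rec x S hne]
      split_ifs
      · exact Finset.sum_nonneg fun i hi => ih _ (Finset.erase_ssubset hi)
      · exact le_rfl

lemma negOrderings_congr {x y : ι → ℝ} (S : Finset ι) (h : ∀ i ∈ S, x i = y i) :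
    negOrderings x S = negOrderings y S := by
  induction S using Finset.strongInduction with
  | H S ih =>
    rcases S.eq_empty_or_nonempty with rfl | hne
    · simp [negOrderings_empty]
    · rw [negOrderings_rec x S hne, negOrderings_rec y S hne, Finset.sum_congr rfl h,
        Finset.sum_congr rfl fun i hi => ih _ (Finset.erase_ssubset hi)
          fun j hj => h j (Finset.mem_of_mem_erase hj)]

lemma measurable_negOrderings (S : Finset ι) :
    Measurable fun x : ι → ℝ => negOrderings x S := by
  induction S using Finset.strongInduction with
  | H S ih =>
    rcases S.eq_empty_or_nonempty with rfl | hne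
    · simp [negOrderings_empty]
    · simp_rw [negOrderings_rec _ S hne]
      refine Measurable.ite (measurableSet_le (by fun_prop) measurable_const)
        (Finset.measurable_sum _ fun i hi => ih _ (Finset.erase_ssubset hi)) measurable_const

end Combinatorics

section RandomWalk

lemma lintegral_comp_prod_of_indepFun {Ω' α β : Type*} [MeasurableSpace Ω'] [MeasurableSpace α]
    [MeasurableSpace β] {P : Measure Ω'} [IsFiniteMeasure P] {A : Ω' → α} {B : Ω' → β}
    (h : IndepFun A B P) (hA : AEMeasurable A P) (hB : AEMeasurable B P) {f : α → β → ENNReal}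
    (hf : Measurable (Function.uncurry f)) :
    ∫⁻ ω, f (A ω) (B ω) ∂P = ∫⁻ b, ∫⁻ ω, f (A ω) b ∂P ∂(P.map B) := by
  have h1 := h.map_prod_eq_prod_map_map hA hB
  have h2 : ∫⁻ ω, f (A ω) (B ω) ∂P
      = ∫⁻ z, Function.uncurry f z ∂(P.map fun ω => (A ω, B ω)) := by
    rw [lintegral_map' hf.aemeasurable (hA.prodMk hB)]; rfl
  rw [h2, h1, lintegral_prod_symm' _ hf]
  refine lintegral_congr fun b => ?_
  rw [lintegral_map' (by fun_prop) hA]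
  rfl

/-- The law of the random walk with step distribution `m` at time `n`, on the event that it has
stayed in `(-∞, 0]` at all times `1, …, n`. -/
def negWalk (m : Measure ℝ) : ℕ → Measure ℝ
  | 0 => Measure.dirac 0
  | n + 1 => (Measure.conv (negWalk m n) m).restrict (Set.Iic 0)

variable (m : Measure ℝ)

instance isFiniteMeasure_negWalk [IsProbabilityMeasure m] (n : ℕ) :
    IsFiniteMeasure (negWalk m n) := by
  induction n with
  | zero => rw [negWalk]; infer_instance
  | succ n ih => rw [negWalk]; infer_instance

lemma negWalk_univ_le_one [IsProbabilityMeasure m] (n : ℕ) : negWalk m n Set.univ ≤ 1 := by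
  induction n with
  | zero => simp [negWalk]
  | succ n ih =>
    rw [negWalk]
    refine (Measure.restrict_apply_le _ _).trans ?_
    rw [Measure.conv, Measure.map_apply (by fun_prop) MeasurableSet.univ]
    simpa [← Set.univ_prod_univ, Measure.prod_prod] using ih

instance isProbabilityMeasure_convNPow [IsProbabilityMeasure m] (n : ℕ) :
    IsProbabilityMeasure (convNPow m n) := by
  induction n with
  | zero => rw [convNPow]; infer_instance
  | succ n ih => rw [convNPow]; infer_instance

variable {Ω' : Type*} [MeasurableSpace Ω'] {P : Measure Ω'}
  {ξ : ℕ → Ω' → ℝ}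

lemma map_sum_eq_convNPow [IsProbabilityMeasure P] (hξ : ∀ i, Measurable (ξ i))
    (hlaw : ∀ i, P.map (ξ i) = m)
    (hind : iIndepFun ξ P) (S : Finset ℕ) :
    P.map (fun ω => ∑ i ∈ S, ξ i ω) = convNPow m S.card := by
  induction S using Finset.induction_on with
  | empty => simp [convNPow]
  | insert a S ha ih =>
    have h : IndepFun (∑ i ∈ S, ξ i) (ξ a) P := hind.indepFun_finsetSum_of_notMem hξ ha
    have h2 := h.map_add_eq_map_conv_map (by fun_prop) (hξ a)
    rw [Finset.card_insert_of_notMem ha, convNPow, ← ih, ← hlaw a]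
    convert h2 using 2
    · ext ω; simp [Finset.sum_insert ha, add_comm]
    · congr 1; ext ω; simp

lemma indepFun_comp_of_disjoint {α β : Type*} [MeasurableSpace α] [MeasurableSpace β]
    (hξ : ∀ i, Measurable (ξ i)) (hind : iIndepFun ξ P) {U V : Finset ℕ} (hUV : Disjoint U V)
    {F : (ℕ → ℝ) → α} {G : (ℕ → ℝ) → β} (hF : Measurable F) (hG : Measurable G)
    (hFU : ∀ x y, (∀ i ∈ U, x i = y i) → F x = F y)
    (hGV : ∀ x y, (∀ i ∈ V, x i = y i) → G x = G y) :
    IndepFun (fun ω => F fun i => ξ i ω) (fun ω => G fun i => ξ i ω) P := by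
  let ext : ∀ W : Finset ℕ, ((i : W) → ℝ) → ℕ → ℝ :=
    fun W x j => if h : j ∈ W then x ⟨j, h⟩ else 0
  have hext : ∀ W, Measurable (ext W) := by
    refine fun W => measurable_pi_lambda _ fun j => ?_
    by_cases h : j ∈ W
    · simp only [ext, h, dite_true]; fun_prop
    · simp only [ext, h, dite_false]; fun_prop
  have hag : ∀ (W : Finset ℕ) ω, ∀ j ∈ W, ext W (fun k => ξ k ω) j = ξ j ω :=
    fun W ω j hj => by simp only [ext, hj, dite_true]
  have h := (hind.indepFun_finset U V hUV hξ).comp (hF.comp (hext U)) (hG.comp (hext V))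
  exact h.congr (ae_of_all _ fun ω => hFU _ _ (hag U ω)) (ae_of_all _ fun ω => hGV _ _ (hag V ω))

lemma lintegral_negOrderings [IsProbabilityMeasure m] [IsProbabilityMeasure P]
    (hξ : ∀ i, Measurable (ξ i)) (hlaw : ∀ i, P.map (ξ i) = m)
    (hind : iIndepFun ξ P) (S : Finset ℕ) {φ : ℝ → ENNReal} (hφ : Measurable φ) :
    ∫⁻ ω, ENNReal.ofReal (negOrderings (fun i => ξ i ω) S) * φ (∑ i ∈ S, ξ i ω) ∂P
      = (S.card.factorial : ENNReal) * ∫⁻ z, φ z ∂(negWalk m S.card) := by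
  induction S using Finset.strongInduction generalizing φ with
  | H S ih =>
    rcases S.eq_empty_or_nonempty with rfl | hne
    · simp [negOrderings_empty, negWalk, lintegral_dirac' _ hφ]
    set ψ : ℝ → ENNReal := (Set.Iic 0).indicator φ with hψ
    have hψm : Measurable ψ := hφ.indicator measurableSet_Iic
    have hmeas : ∀ U : Finset ℕ, Measurable fun ω => negOrderings (fun i => ξ i ω) U := fun U =>
      (measurable_negOrderings U).comp (measurable_pi_lambda _ hξ)
    have hstep : ∀ ω, ENNReal.ofReal (negOrderings (fun i => ξ i ω) S) * φ (∑ i ∈ S, ξ i ω)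
        = ∑ i ∈ S, ENNReal.ofReal (negOrderings (fun i => ξ i ω) (S.erase i))
          * ψ (∑ j ∈ S.erase i, ξ j ω + ξ i ω) := by
      intro ω
      have h1 : ∀ i ∈ S, ENNReal.ofReal (negOrderings (fun i => ξ i ω) (S.erase i))
          * ψ (∑ j ∈ S.erase i, ξ j ω + ξ i ω)
          = ENNReal.ofReal (negOrderings (fun i => ξ i ω) (S.erase i))
          * ψ (∑ j ∈ S, ξ j ω) := fun i hi => by
        rw [Finset.sum_erase_add _ _ hi]
      rw [Finset.sum_congr rfl h1, ← Finset.sum_mul, negOrderings_rec _ S hne,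
        ← ENNReal.ofReal_sum_of_nonneg fun i _ => negOrderings_nonneg _ _]
      by_cases h : ∑ i ∈ S, ξ i ω ≤ 0
      · simp [hψ, h]
      · simp [hψ, h]
    have hterm : ∀ i ∈ S, ∫⁻ ω, ENNReal.ofReal (negOrderings (fun i => ξ i ω) (S.erase i))
          * ψ (∑ j ∈ S.erase i, ξ j ω + ξ i ω) ∂P
        = ((S.card - 1).factorial : ENNReal) * ∫⁻ z, φ z ∂(negWalk m S.card) := by
      intro i hi
      have hcard : S.card = (S.card - 1) + 1 := (Nat.sub_add_cancel hne.card_pos).symm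
      have hind2 : IndepFun (fun ω => (negOrderings (fun i => ξ i ω) (S.erase i),
          ∑ j ∈ S.erase i, ξ j ω)) (ξ i) P := by
        refine indepFun_comp_of_disjoint hξ hind (U := S.erase i) (V := {i}) (by simp)
          (F := fun x => (negOrderings x (S.erase i), ∑ j ∈ S.erase i, x j))
          (G := fun x => x i) ((measurable_negOrderings _).prodMk (by fun_prop)) (by fun_prop)
          (fun x y h => ?_) (fun x y h => h i (by simp))
        rw [negOrderings_congr _ h, Finset.sum_congr rfl h]
      rw [lintegral_comp_prod_of_indepFun (f := fun a b => ENNReal.ofReal a.1 * ψ (a.2 + b)) hind2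
        ((hmeas _).prodMk (Finset.measurable_sum _ fun j _ => hξ j)).aemeasurable
        (hξ i).aemeasurable (by simp only [Function.uncurry_def]; fun_prop)]
      simp only
      have h3 : ∀ b, ∫⁻ ω, ENNReal.ofReal (negOrderings (fun i => ξ i ω) (S.erase i))
            * ψ (∑ j ∈ S.erase i, ξ j ω + b) ∂P
          = ((S.card - 1).factorial : ENNReal) * ∫⁻ z, ψ (z + b) ∂(negWalk m (S.card - 1)) := by
        intro b
        rw [ih (S.erase i) (Finset.erase_ssubset hi) (φ := fun z => ψ (z + b)) (by fun_prop),
          Finset.card_erase_of_mem hi]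
      simp_rw [h3]
      rw [lintegral_const_mul _ (by
        refine Measurable.lintegral_prod_left' (f := fun z : ℝ × ℝ => ψ (z.1 + z.2)) ?_
        fun_prop), hlaw]
      congr 1
      conv_rhs => rw [hcard, negWalk, ← lintegral_indicator measurableSet_Iic,
        Measure.lintegral_conv hψm]
      rw [lintegral_lintegral_swap (by
        simp only [Function.uncurry_def]; fun_prop)]
    simp_rw [hstep]
    rw [lintegral_finsetSum _ (fun i _ => by
      refine (hmeas _).ennreal_ofReal.mul (hψm.comp ?_)
      exact (Finset.measurable_sum _ fun j _ => hξ j).add (hξ i)), Finset.sum_congr rfl hterm,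
      Finset.sum_const, nsmul_eq_mul, ← mul_assoc,
      ← Nat.mul_factorial_pred hne.card_ne_zero]
    push_cast; rfl

/-- Sparre Andersen's identity for the probability of staying in `(-∞, 0]`. -/
lemma nat_mul_negWalk_univ [IsProbabilityMeasure m] (n : ℕ) :
    (n : ℝ) * (negWalk m n).real Set.univ
      = ∑ k ∈ Finset.range n, (convNPow m (k + 1)).real (Set.Iic 0)
        * (negWalk m (n - 1 - k)).real Set.univ := by
  obtain ⟨Ω', mΩ', P, ξ, hξ, hlaw', hind, hP⟩ := exists_iid ℕ m
  have hlaw : ∀ i, P.map (ξ i) = m := fun i => (hlaw' i).map_eq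
  have hmeas : ∀ U : Finset ℕ, Measurable fun ω => negOrderings (fun i => ξ i ω) U := fun U =>
    (measurable_negOrderings U).comp (measurable_pi_lambda _ hξ)
  have hA : ∀ U : Finset ℕ, ∫⁻ ω, ENNReal.ofReal (negOrderings (fun i => ξ i ω) U) ∂P
      = (U.card.factorial : ENNReal) * negWalk m U.card Set.univ := by
    intro U
    have h := lintegral_negOrderings m hξ hlaw hind U (φ := fun _ => 1) measurable_const
    simpa using h
  have hintU : ∀ U : Finset ℕ, Integrable (fun ω => negOrderings (fun i => ξ i ω) U) P := by
    intro U
    refine ⟨(hmeas U).aestronglyMeasurable, ?_⟩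
    rw [hasFiniteIntegral_iff_ofReal (ae_of_all _ fun ω => negOrderings_nonneg _ _), hA]
    exact ENNReal.mul_lt_top (by simp) (measure_lt_top _ _)
  have hE : ∀ U : Finset ℕ, ∫ ω, negOrderings (fun i => ξ i ω) U ∂P
      = (U.card.factorial : ℝ) * (negWalk m U.card).real Set.univ := by
    intro U
    rw [integral_eq_lintegral_of_nonneg_ae (ae_of_all _ fun ω => negOrderings_nonneg _ _)
      (hmeas U).aestronglyMeasurable, hA, ENNReal.toReal_mul]
    simp [Measure.real]
  have hT : ∀ T ∈ (Finset.range n).powerset,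
      Integrable (fun ω => (if ∑ i ∈ T, ξ i ω ≤ 0 then factWeight T else 0)
        * negOrderings (fun i => ξ i ω) (Finset.range n \ T)) P ∧
      ∫ ω, (if ∑ i ∈ T, ξ i ω ≤ 0 then factWeight T else 0)
        * negOrderings (fun i => ξ i ω) (Finset.range n \ T) ∂P
      = factWeight T * (convNPow m T.card).real (Set.Iic 0)
        * (((n - T.card).factorial : ℝ) * (negWalk m (n - T.card)).real Set.univ) := by
    intro T hTn
    have hs : MeasurableSet {ω | ∑ i ∈ T, ξ i ω ≤ 0} :=
      measurableSet_le (by fun_prop) measurable_const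
    have hm1 : Measurable fun ω => if ∑ i ∈ T, ξ i ω ≤ 0 then factWeight T else 0 :=
      Measurable.ite hs measurable_const measurable_const
    have hi1 : Integrable (fun ω => if ∑ i ∈ T, ξ i ω ≤ 0 then factWeight T else 0) P := by
      have := (integrable_const (μ := P) (factWeight T)).indicator hs
      refine this.congr (ae_of_all _ fun ω => ?_)
      simp [Set.indicator]
    have hI : IndepFun (fun ω => if ∑ i ∈ T, ξ i ω ≤ 0 then factWeight T else 0)
        (fun ω => negOrderings (fun i => ξ i ω) (Finset.range n \ T)) P := by
      refine indepFun_comp_of_disjoint hξ hind (U := T) Finset.disjoint_sdiff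
        (F := fun x => if ∑ i ∈ T, x i ≤ 0 then factWeight T else 0)
        (Measurable.ite (measurableSet_le (by fun_prop) measurable_const) measurable_const
          measurable_const) (measurable_negOrderings _) (fun x y h => ?_)
        (fun x y h => negOrderings_congr _ h)
      simp only [Finset.sum_congr rfl h]
    refine ⟨hI.integrable_mul hi1 (hintU _), ?_⟩
    have h1 := hI.integral_fun_mul_eq_mul_integral hm1.aestronglyMeasurable
      (hmeas _).aestronglyMeasurable
    rw [h1, hE, Finset.card_sdiff_of_subset (Finset.mem_powerset.1 hTn), Finset.card_range]
    congr 1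
    have h2 : (fun ω => if ∑ i ∈ T, ξ i ω ≤ 0 then factWeight T else 0)
        = {ω | ∑ i ∈ T, ξ i ω ≤ 0}.indicator fun _ => factWeight T := by
      ext ω; simp [Set.indicator]
    rw [h2, integral_indicator_const _ hs, ← map_sum_eq_convNPow m hξ hlaw hind T,
      map_measureReal_apply (by fun_prop) measurableSet_Iic, smul_eq_mul, mul_comm]
    rfl
  have hmain : (n : ℝ) * ((n.factorial : ℝ) * (negWalk m n).real Set.univ)
      = ∑ T ∈ (Finset.range n).powerset, factWeight T * (convNPow m T.card).real (Set.Iic 0)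
        * (((n - T.card).factorial : ℝ) * (negWalk m (n - T.card)).real Set.univ) := by
    have h1 := hE (Finset.range n)
    rw [Finset.card_range] at h1
    rw [← h1, ← integral_const_mul]
    have h2 : ∀ ω, (n : ℝ) * negOrderings (fun i => ξ i ω) (Finset.range n)
        = ∑ T ∈ (Finset.range n).powerset, (if ∑ i ∈ T, ξ i ω ≤ 0 then factWeight T else 0)
        * negOrderings (fun i => ξ i ω) (Finset.range n \ T) := by
      intro ω
      have := card_mul_negOrderings (fun i => ξ i ω) (Finset.range n)
      rwa [Finset.card_range] at this
    simp_rw [h2]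
    rw [integral_finsetSum _ fun T hTn => (hT T hTn).1]
    exact Finset.sum_congr rfl fun T hTn => (hT T hTn).2
  have hw : ∀ T : Finset ℕ, factWeight T
      = if T.card = 0 then (0 : ℝ) else (T.card.factorial : ℝ) := by
    intro T
    rcases T.eq_empty_or_nonempty with rfl | h
    · simp [factWeight]
    · simp [factWeight, h, h.ne_empty]
  simp_rw [hw] at hmain
  rw [Finset.sum_powerset_apply_card (fun k => (if k = 0 then (0 : ℝ) else (k.factorial : ℝ))
    * (convNPow m k).real (Set.Iic 0)
    * (((n - k).factorial : ℝ) * (negWalk m (n - k)).real Set.univ)), Finset.card_range,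
    Finset.sum_range_succ'] at hmain
  have hn : (n.factorial : ℝ) ≠ 0 := by positivity
  refine mul_left_cancel₀ hn ?_
  rw [mul_left_comm, hmain, Finset.mul_sum]
  simp only [if_true, zero_mul, smul_zero, add_zero]
  refine Finset.sum_congr rfl fun k hk => ?_
  have hk' : k + 1 ≤ n := Finset.mem_range.1 hk
  rw [if_neg (by omega), nsmul_eq_mul, ← Nat.choose_mul_factorial_mul_factorial hk',
    show n - 1 - k = n - (k + 1) by omega]
  push_cast; ring

end RandomWalk

section GeneratingFunction

lemma hasDerivAt_tsum_mul_pow {a : ℕ → ℝ} (ha : ∀ n, |a n| ≤ 1) {z : ℝ} (hz : |z| < 1) :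
    HasDerivAt (fun y => ∑' n, a n * y ^ n) (∑' n : ℕ, ((n : ℝ) + 1) * a (n + 1) * z ^ n) z := by
  obtain ⟨ρ, hzρ, hρ⟩ := exists_between hz
  have hρ0 : 0 < ρ := (abs_nonneg z).trans_lt hzρ
  have hsum0 : Summable fun n : ℕ => ((n : ℝ) + 1) * ρ ^ n := by
    have h1 := summable_pow_mul_geometric_of_norm_lt_one 1 (r := ρ)
      (by rwa [Real.norm_eq_abs, abs_of_pos hρ0])
    have h2 := summable_geometric_of_lt_one hρ0.le hρ
    refine (h1.add h2).congr fun n => by ring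
  have hsum : Summable fun n : ℕ => (n : ℝ) * ρ ^ (n - 1) := by
    refine (summable_nat_add_iff 1).1 (hsum0.congr fun n => ?_)
    push_cast; simp
  have h := hasDerivAt_tsum_of_isPreconnected (t := Metric.ball (0 : ℝ) ρ)
    (g := fun n y => a n * y ^ n) (g' := fun n y => a n * (n * y ^ (n - 1))) (y₀ := 0) (y := z)
    hsum Metric.isOpen_ball (convex_ball _ _).isPreconnected
    (fun n y _ => (hasDerivAt_pow n y).const_mul (a n)) (fun n y hy => ?_) (by simpa using hρ0) ?_
    (by simpa using hzρ)
  · refine h.congr_deriv ?_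
    rw [Summable.tsum_eq_zero_add]
    · simp only [CharP.cast_eq_zero, zero_mul, mul_zero, zero_add]
      refine tsum_congr fun n => ?_
      rw [Nat.add_sub_cancel]
      push_cast
      ring
    · refine Summable.of_norm_bounded hsum fun n => ?_
      rw [norm_mul, norm_mul, Real.norm_eq_abs, norm_pow, Real.norm_natCast]
      have : ‖z‖ ^ (n - 1) ≤ ρ ^ (n - 1) := pow_le_pow_left₀ (norm_nonneg _) hzρ.le _
      calc |a n| * (n * ‖z‖ ^ (n - 1)) ≤ 1 * (n * ρ ^ (n - 1)) := by gcongr; exact ha n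
        _ = _ := one_mul _
  · have hy' : ‖y‖ ≤ ρ := by simpa using (mem_ball_zero_iff.1 hy).le
    rw [norm_mul, norm_mul, Real.norm_eq_abs, norm_pow, Real.norm_natCast]
    calc |a n| * (n * ‖y‖ ^ (n - 1)) ≤ 1 * (n * ρ ^ (n - 1)) := by gcongr; exact ha n
      _ = _ := one_mul _
  · refine summable_of_ne_finset_zero (s := {0}) fun n hn => ?_
    simp at hn
    simp [hn]

lemma summable_norm_mul_pow {a : ℕ → ℝ} (ha : ∀ n, |a n| ≤ 1) {z : ℝ} (hz : |z| < 1) :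
    Summable fun n => ‖a n * z ^ n‖ := by
  refine Summable.of_nonneg_of_le (fun n => norm_nonneg _) (fun n => ?_)
    (summable_geometric_of_lt_one (abs_nonneg z) hz)
  rw [norm_mul, norm_pow, Real.norm_eq_abs, Real.norm_eq_abs]
  exact mul_le_of_le_one_left (by positivity) (ha n)

lemma tsum_mul_pow_eq_exp {p r : ℕ → ℝ} (hp : ∀ n, |p n| ≤ 1) (hr : ∀ n, |r n| ≤ 1)
    (hp0 : p 0 = 1)
    (hrec : ∀ n : ℕ, (n : ℝ) * p n = ∑ k ∈ Finset.range n, r (k + 1) * p (n - 1 - k))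
    {s : ℝ} (hs0 : 0 ≤ s) (hs : s < 1) :
    ∑' n, p n * s ^ n = Real.exp (∑' n : ℕ, r n / n * s ^ n) := by
  set F : ℝ → ℝ := fun y => ∑' n, p n * y ^ n with hF
  set R : ℝ → ℝ := fun y => ∑' n : ℕ, r n / n * y ^ n with hR
  have hrn : ∀ n : ℕ, |r n / n| ≤ 1 := by
    intro n
    rcases Nat.eq_zero_or_pos n with rfl | hn
    · simp
    · rw [abs_div, Nat.abs_cast]
      exact div_le_one_of_le₀ ((hr n).trans (by exact_mod_cast hn)) (by positivity)
  have hFd : ∀ z, |z| < 1 → HasDerivAt F ((∑' n, r (n + 1) * z ^ n) * F z) z := by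
    intro z hz
    refine (hasDerivAt_tsum_mul_pow hp hz).congr_deriv ?_
    rw [eq_comm, hF, tsum_mul_tsum_eq_tsum_sum_range_of_summable_norm
      (summable_norm_mul_pow (a := fun n => r (n + 1)) (fun n => hr (n + 1)) hz)
      (summable_norm_mul_pow hp hz)]
    refine tsum_congr fun n => ?_
    have h := hrec (n + 1)
    push_cast at h
    rw [h, Finset.sum_mul]
    refine Finset.sum_congr rfl fun k hk => ?_
    have hk' : k ≤ n := Nat.lt_succ_iff.1 (Finset.mem_range.1 hk)
    rw [← pow_mul_pow_sub z hk']
    ring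
  have hRd : ∀ z, |z| < 1 → HasDerivAt R (∑' n, r (n + 1) * z ^ n) z := by
    intro z hz
    refine (hasDerivAt_tsum_mul_pow hrn hz).congr_deriv ?_
    refine tsum_congr fun n => ?_
    push_cast
    field_simp
  have hD : ∀ z, |z| < 1 → HasDerivAt (fun y => F y * Real.exp (-R y)) 0 z := by
    intro z hz
    refine ((hFd z hz).mul (hRd z hz).neg.exp).congr_deriv ?_
    ring
  have habs : ∀ z ∈ Set.Icc 0 s, |z| < 1 := fun z hz => by
    rw [abs_of_nonneg hz.1]; exact hz.2.trans_lt hs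
  have hconst := constant_of_has_deriv_right_zero (f := fun y => F y * Real.exp (-R y)) (a := 0)
    (b := s) (fun z hz => (hD z (habs z hz)).continuousAt.continuousWithinAt)
    (fun z hz => (hD z (habs z (Set.Ico_subset_Icc_self hz))).hasDerivWithinAt) s
    (Set.right_mem_Icc.2 hs0)
  have hF0 : F 0 = 1 := by
    rw [hF]; simp only
    rw [tsum_eq_single 0 (fun n hn => by simp [hn])]; simp [hp0]
  have hR0 : R 0 = 0 := by
    rw [hR]; simp only
    rw [tsum_eq_single 0 (fun n hn => by simp [hn])]; simp
  simp only [hF0, hR0, neg_zero, Real.exp_zero, mul_one] at hconst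
  rw [Real.exp_neg, mul_inv_eq_one₀ (Real.exp_ne_zero _)] at hconst
  exact hconst

end GeneratingFunction

section Occupation

open scoped ENNReal

lemma measure_Iic_pow_succ (ν : Measure ℝ) [SFinite ν] [NullSingletonClass ν] (n : ℕ) (t : ℝ) :
    ν (Set.Iic t) ^ (n + 1) = (n + 1 : ℝ≥0∞) * ∫⁻ s in Set.Iic t, ν (Set.Iic s) ^ n ∂ν := by
  have hb : Measurable fun s => ν (Set.Iic s) :=
    Monotone.measurable fun s r h => measure_mono (Set.Iic_subset_Iic.2 h)
  induction n generalizing t with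
  | zero => simp
  | succ n ih =>
    have h1 : ∀ s ∈ Set.Iic t, ν (Set.Iic s) ^ n * ν (Set.Iic t)
        = ν (Set.Iic s) ^ (n + 1) + ∫⁻ r in Set.Iic t,
          (Set.Ioi s).indicator (fun _ => ν (Set.Iic s) ^ n) r ∂ν := by
      intro s hs
      rw [lintegral_indicator measurableSet_Ioi, Measure.restrict_restrict measurableSet_Ioi,
        Set.Ioi_inter_Iic, lintegral_const, Measure.restrict_apply MeasurableSet.univ,
        Set.univ_inter, pow_succ, ← mul_add, ← measure_union _ measurableSet_Ioc,
        Set.Iic_union_Ioc_eq_Iic hs]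
      exact Set.disjoint_left.2 fun x hx hx' => (not_lt.2 hx) hx'.1
    have hm : Measurable (Function.uncurry fun s r : ℝ =>
        (Set.Ioi s).indicator (fun _ => ν (Set.Iic s) ^ n) r) := by
      have : (Function.uncurry fun s r : ℝ => (Set.Ioi s).indicator (fun _ => ν (Set.Iic s) ^ n) r)
          = {p : ℝ × ℝ | p.1 < p.2}.indicator fun p => ν (Set.Iic p.1) ^ n := by
        ext ⟨s, r⟩; simp [Set.indicator]
      rw [this]
      exact ((hb.comp measurable_fst).pow_const n).indicator
        (measurableSet_lt measurable_fst measurable_snd)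
    have h2 : ∫⁻ s in Set.Iic t, ∫⁻ r in Set.Iic t,
          (Set.Ioi s).indicator (fun _ => ν (Set.Iic s) ^ n) r ∂ν ∂ν
        = ∫⁻ r in Set.Iic t, ∫⁻ s in Set.Iic r, ν (Set.Iic s) ^ n ∂ν ∂ν := by
      rw [lintegral_lintegral_swap hm.aemeasurable]
      refine setLIntegral_congr_fun measurableSet_Iic fun r hr => ?_
      have : ∀ s, (Set.Ioi s).indicator (fun _ => ν (Set.Iic s) ^ n) r
          = (Set.Iio r).indicator (fun s => ν (Set.Iic s) ^ n) s := by
        intro s; simp [Set.indicator]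
      simp_rw [this]
      rw [lintegral_indicator measurableSet_Iio, Measure.restrict_restrict measurableSet_Iio,
        Set.inter_eq_left.2 (Set.Iio_subset_Iic hr),
        Measure.restrict_congr_set Iio_ae_eq_Iic]
    have hmI : Measurable fun r => ∫⁻ s in Set.Iic r, ν (Set.Iic s) ^ n ∂ν :=
      Monotone.measurable fun r r' h => lintegral_mono_set (Set.Iic_subset_Iic.2 h)
    rw [pow_succ, ih, mul_assoc, ← lintegral_mul_const _ (hb.pow_const n),
      setLIntegral_congr_fun measurableSet_Iic h1, lintegral_add_left (hb.pow_const _), h2, mul_add,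
      ← lintegral_const_mul _ hmI]
    simp_rw [← ih]
    push_cast; ring

lemma lintegral_Ioc_pow_succ {j : ℝ → ℝ≥0∞} (hj : Measurable j) (n : ℕ) (t : ℝ) :
    (∫⁻ s in Set.Ioc 0 t, j s) ^ (n + 1)
      = (n + 1 : ℝ≥0∞) * ∫⁻ s in Set.Ioc 0 t, j s * (∫⁻ u in Set.Ioc 0 s, j u) ^ n := by
  set ν : Measure ℝ := (volume.restrict (Set.Ioi 0)).withDensity j with hν
  have h1 : ∀ t, ν (Set.Iic t) = ∫⁻ s in Set.Ioc 0 t, j s := by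
    intro t
    rw [hν, withDensity_apply _ measurableSet_Iic, Measure.restrict_restrict measurableSet_Iic,
      Set.Iic_inter_Ioi]
  have hb : Measurable fun s => ν (Set.Iic s) :=
    Monotone.measurable fun s r h => measure_mono (Set.Iic_subset_Iic.2 h)
  have h2 := measure_Iic_pow_succ ν n t
  rw [← lintegral_indicator measurableSet_Iic, hν, lintegral_withDensity_eq_lintegral_mul _ hj
    ((hb.pow_const n).indicator measurableSet_Iic), ← hν] at h2
  simp_rw [← h1]
  rw [h2]
  congr 1
  have : (j * (Set.Iic t).indicator fun s => ν (Set.Iic s) ^ n)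
      = (Set.Iic t).indicator fun s => j s * ν (Set.Iic s) ^ n := by
    ext s; by_cases h : s ≤ t <;> simp [h]
  rw [this, lintegral_indicator measurableSet_Iic, Measure.restrict_restrict measurableSet_Iic,
      Set.Iic_inter_Ioi]

lemma lintegral_Ioi_Ioc_eq {F : ℝ → ℝ → ℝ≥0∞} (hF : Measurable (Function.uncurry F)) :
    ∫⁻ t in Set.Ioi 0, ∫⁻ s in Set.Ioc 0 t, F s t
      = ∫⁻ s in Set.Ioi 0, ∫⁻ r in Set.Ioi 0, F s (s + r) := by
  have hm : Measurable fun p : ℝ × ℝ =>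
      {p : ℝ × ℝ | p.2 < p.1}.indicator (fun p => F p.2 p.1) p :=
    (hF.comp measurable_swap).indicator (measurableSet_lt measurable_snd measurable_fst)
  have h1 : ∀ t ∈ Set.Ioi (0 : ℝ), ∫⁻ s in Set.Ioc 0 t, F s t
      = ∫⁻ s in Set.Ioi 0, {p : ℝ × ℝ | p.2 < p.1}.indicator (fun p => F p.2 p.1) (t, s) := by
    intro t _
    have : ∀ s, {p : ℝ × ℝ | p.2 < p.1}.indicator (fun p => F p.2 p.1) (t, s)
        = (Set.Iio t).indicator (fun s => F s t) s := by
      intro s; simp [Set.indicator]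
    simp_rw [this]
    rw [lintegral_indicator measurableSet_Iio, Measure.restrict_restrict measurableSet_Iio,
      Set.Iio_inter_Ioi, Measure.restrict_congr_set Ioo_ae_eq_Ioc]
  rw [setLIntegral_congr_fun measurableSet_Ioi h1, lintegral_lintegral_swap hm.aemeasurable]
  refine setLIntegral_congr_fun measurableSet_Ioi fun s hs => ?_
  have : ∀ t, {p : ℝ × ℝ | p.2 < p.1}.indicator (fun p => F p.2 p.1) (t, s)
      = (Set.Ioi s).indicator (fun t => F s t) t := by
    intro t; simp [Set.indicator]
  simp_rw [this]
  rw [lintegral_indicator measurableSet_Ioi, Measure.restrict_restrict measurableSet_Ioi,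
    Set.inter_eq_left.2 (Set.Ioi_subset_Ioi (le_of_lt hs)), ← lintegral_indicator measurableSet_Ioi,
    ← lintegral_indicator measurableSet_Ioi,
    ← lintegral_add_left_eq_self ((Set.Ioi s).indicator fun t => F s t) s]
  refine lintegral_congr fun r => ?_
  simp [Set.indicator]

lemma lintegral_expMeasure (r : ℝ) {f : ℝ → ℝ≥0∞} (hf : Measurable f) :
    ∫⁻ t, f t ∂(expMeasure r)
      = ∫⁻ t in Set.Ioi 0, ENNReal.ofReal (r * Real.exp (-r * t)) * f t := by
  have hm : Measurable (exponentialPDF r) := (measurable_exponentialPDFReal r).ennreal_ofReal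
  have h0 : expMeasure r = volume.withDensity (exponentialPDF r) := rfl
  rw [h0, lintegral_withDensity_eq_lintegral_mul _ hm hf, ← setLIntegral_univ,
    ← Set.Iio_union_Ici (a := (0 : ℝ)), lintegral_union measurableSet_Ici
      (Set.Iio_disjoint_Ici le_rfl),
    Measure.restrict_congr_set (Ioi_ae_eq_Ici (a := (0 : ℝ))).symm,
    setLIntegral_congr_fun (g := fun _ => 0) measurableSet_Iio
      (fun x hx => by simp [exponentialPDF_of_neg hx])]
  simp only [lintegral_zero, zero_add]
  refine setLIntegral_congr_fun measurableSet_Ioi fun t ht => ?_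
  simp [exponentialPDF_of_nonneg (le_of_lt ht)]

lemma lintegral_pow_mul_of_indepFun {P : Measure Ω} [IsProbabilityMeasure P] {Y : ℝ → Ω → ℝ}
    (hY : Measurable (Function.uncurry Y)) {D : Ω → ℝ} (hD : Measurable D) {S : Set ℝ}
    (hS : MeasurableSet S)
    (hind : ∀ (k : ℕ) (v : Fin k → ℝ), (∀ i, v i ∈ S) →
      IndepFun (fun ω (i : Fin k) => Y (v i) ω) D P)
    {w : ℝ → ℝ → ℝ≥0∞} (hw : Measurable (Function.uncurry w)) {f : ℝ → ℝ≥0∞} (hf : Measurable f)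
    (n k : ℕ) (v : Fin k → ℝ) (hv : ∀ i, v i ∈ S) {Ψ : (Fin k → ℝ) → ℝ → ℝ≥0∞}
    (hΨ : Measurable (Function.uncurry Ψ)) :
    ∫⁻ ω, (∫⁻ u in S, w u (D ω) * f (Y u ω)) ^ n * Ψ (fun i => Y (v i) ω) (D ω) ∂P
      = ∫⁻ y, ∫⁻ ω, (∫⁻ u in S, w u y * f (Y u ω)) ^ n * Ψ (fun i => Y (v i) ω) y ∂P
          ∂(P.map D) := by
  have hYt : ∀ t, Measurable (Y t) := fun t => hY.comp measurable_prodMk_left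
  have hK : Measurable fun p : ℝ × Ω => ∫⁻ u in S, w u p.1 * f (Y u p.2) := by
    refine Measurable.lintegral_prod_right'
      (f := fun z : (ℝ × Ω) × ℝ => w z.2 z.1.1 * f (Y z.2 z.1.2)) ?_
    refine (hw.comp (measurable_snd.prodMk (measurable_fst.comp measurable_fst))).mul (hf.comp ?_)
    exact hY.comp (measurable_snd.prodMk (measurable_snd.comp measurable_fst))
  induction n generalizing k with
  | zero =>
    simp only [pow_zero, one_mul]
    exact lintegral_comp_prod_of_indepFun (hind k v hv)
      (measurable_pi_lambda _ fun i => hYt _).aemeasurable hD.aemeasurable hΨ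
  | succ n ih =>
    let Ψ' : ℝ → (Fin (k + 1) → ℝ) → ℝ → ℝ≥0∞ := fun u z y => w u y * f (z 0) * Ψ (Fin.tail z) y
    have hexp : ∀ ω y, (∫⁻ u in S, w u y * f (Y u ω)) ^ (n + 1) * Ψ (fun i => Y (v i) ω) y
        = ∫⁻ u in S, (∫⁻ u in S, w u y * f (Y u ω)) ^ n
          * Ψ' u (fun i => Y ((Fin.cons u v : Fin (k + 1) → ℝ) i) ω) y := by
      intro ω y
      have hm : Measurable fun u => w u y * f (Y u ω) :=
        (hw.comp measurable_prodMk_right).mul (hf.comp (hY.comp measurable_prodMk_right))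
      rw [pow_succ, mul_assoc, ← lintegral_mul_const _ hm, ← lintegral_const_mul _ (hm.mul_const _)]
      rfl
    have hm3 : Measurable fun p : ℝ × ℝ × Ω => (∫⁻ u in S, w u p.2.1 * f (Y u p.2.2)) ^ n
          * Ψ' p.1 (fun i => Y ((Fin.cons p.1 v : Fin (k + 1) → ℝ) i) p.2.2) p.2.1 := by
      refine ((hK.comp measurable_snd).pow_const n).mul (Measurable.mul (Measurable.mul ?_ ?_) ?_)
      · exact hw.comp (measurable_fst.prodMk (measurable_fst.comp measurable_snd))
      · exact hf.comp (hY.comp (measurable_fst.prodMk (measurable_snd.comp measurable_snd)))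
      · refine hΨ.comp (Measurable.prodMk (measurable_pi_lambda _ fun i => ?_)
          (measurable_fst.comp measurable_snd))
        exact (hYt (v i)).comp (measurable_snd.comp measurable_snd)
    have hΨ' : ∀ u, Measurable (Function.uncurry (Ψ' u)) := by
      intro u
      refine Measurable.mul (Measurable.mul ?_ ?_) ?_
      · exact hw.comp (measurable_const.prodMk measurable_snd)
      · exact hf.comp ((measurable_pi_apply 0).comp measurable_fst)
      · refine hΨ.comp (Measurable.prodMk (measurable_pi_lambda _ fun i => ?_) measurable_snd)
        exact (measurable_pi_apply i.succ).comp measurable_fst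
    simp_rw [hexp]
    rw [lintegral_lintegral_swap (by
      exact (hm3.comp (measurable_snd.prodMk
        ((hD.comp measurable_fst).prodMk measurable_fst))).aemeasurable)]
    have hswap : ∀ y, ∫⁻ ω, (∫⁻ u in S, (∫⁻ u in S, w u y * f (Y u ω)) ^ n
          * Ψ' u (fun i => Y ((Fin.cons u v : Fin (k + 1) → ℝ) i) ω) y) ∂P
        = ∫⁻ u in S, ∫⁻ ω, (∫⁻ u in S, w u y * f (Y u ω)) ^ n
          * Ψ' u (fun i => Y ((Fin.cons u v : Fin (k + 1) → ℝ) i) ω) y ∂P := by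
      intro y
      refine lintegral_lintegral_swap (Measurable.aemeasurable ?_)
      exact hm3.comp (measurable_snd.prodMk (measurable_const.prodMk measurable_fst))
    simp_rw [hswap]
    conv_rhs => rw [lintegral_lintegral_swap (by
      refine Measurable.aemeasurable (Measurable.lintegral_prod_right'
        (f := fun z : (ℝ × ℝ) × Ω => (∫⁻ u in S, w u z.1.1 * f (Y u z.2)) ^ n
          * Ψ' z.1.2 (fun i => Y ((Fin.cons z.1.2 v : Fin (k + 1) → ℝ) i) z.2) z.1.1) ?_)
      exact hm3.comp ((measurable_snd.comp measurable_fst).prodMk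
        ((measurable_fst.comp measurable_fst).prodMk measurable_snd)))]
    refine setLIntegral_congr_fun hS fun u hu => ?_
    exact ih (k + 1) (Fin.cons u v) (Fin.cases hu hv) (hΨ' u)

end Occupation

section Resolvent

open scoped ENNReal

/-- The law of `Y` sampled at an independent exponential time of rate `θ`. -/
def sampledLaw (P : Measure Ω) (Y : ℝ → Ω → ℝ) (θ : ℝ) : Measure ℝ :=
  ((expMeasure θ).prod P).map (Function.uncurry Y)

variable {P : Measure Ω} [IsProbabilityMeasure P] {Y : ℝ → Ω → ℝ} {θ : ℝ}

lemma isProbabilityMeasure_sampledLaw (hY : Measurable (Function.uncurry Y)) (hθ : 0 < θ) :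
    IsProbabilityMeasure (sampledLaw P Y θ) := by
  have := isProbabilityMeasure_expMeasure hθ
  exact Measure.isProbabilityMeasure_map hY.aemeasurable

lemma lintegral_sampledLaw (hY : Measurable (Function.uncurry Y)) {φ : ℝ → ℝ≥0∞}
    (hφ : Measurable φ) :
    ∫⁻ y, φ y ∂(sampledLaw P Y θ) = ∫⁻ t, ∫⁻ ω, φ (Y t ω) ∂P ∂(expMeasure θ) := by
  have h : Measurable fun z : ℝ × Ω => φ (Function.uncurry Y z) := hφ.comp hY
  rw [sampledLaw, lintegral_map hφ hY, lintegral_prod _ h.aemeasurable]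
  rfl

lemma measurable_lintegral_Ioc (hY : Measurable (Function.uncurry Y)) {f : ℝ → ℝ≥0∞}
    (hf : Measurable f) : Measurable fun p : ℝ × Ω => ∫⁻ u in Set.Ioc 0 p.1, f (Y u p.2) := by
  have h : ∀ p : ℝ × Ω, ∫⁻ u in Set.Ioc 0 p.1, f (Y u p.2)
      = ∫⁻ u in Set.Ioi 0, {z : (ℝ × Ω) × ℝ | z.2 ≤ z.1.1}.indicator
        (fun z => f (Y z.2 z.1.2)) (p, u) := by
    intro p
    have : ∀ u, {z : (ℝ × Ω) × ℝ | z.2 ≤ z.1.1}.indicator (fun z => f (Y z.2 z.1.2)) (p, u)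
        = (Set.Iic p.1).indicator (fun u => f (Y u p.2)) u := by
      intro u; simp [Set.indicator]
    simp_rw [this]
    rw [lintegral_indicator measurableSet_Iic, Measure.restrict_restrict measurableSet_Iic,
      Set.Iic_inter_Ioi]
  simp_rw [h]
  refine Measurable.lintegral_prod_right' ?_
  have hYz : Measurable fun z : (ℝ × Ω) × ℝ => Y z.2 z.1.2 :=
    hY.comp (by fun_prop : Measurable fun z : (ℝ × Ω) × ℝ => (z.2, z.1.2))
  exact (hf.comp hYz).indicator (measurableSet_le (by fun_prop) (by fun_prop))

lemma lintegral_increment (hY : Measurable (Function.uncurry Y)) (hL : IsLevyProcess P Y)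
    {f φ : ℝ → ℝ≥0∞} (hf : Measurable f) (hφ : Measurable φ) (n : ℕ) {s t : ℝ} (hs : 0 < s)
    (hst : s ≤ t) :
    ∫⁻ ω, (∫⁻ u in Set.Ioc 0 s, f (Y u ω)) ^ n * (f (Y s ω) * φ (Y t ω)) ∂P
      = ∫⁻ ω', ∫⁻ ω, (∫⁻ u in Set.Ioc 0 s, f (Y u ω)) ^ n
        * (f (Y s ω) * φ (Y s ω + Y (t - s) ω')) ∂P ∂P := by
  have h := lintegral_pow_mul_of_indepFun (P := P) hY (D := fun ω => Y t ω - Y s ω)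
    ((hL.measurable t).sub (hL.measurable s)) (S := Set.Ioc 0 s) measurableSet_Ioc
    (fun k v hv => (hL.indep s t hs.le hst k v fun i => ⟨(hv i).1.le, (hv i).2⟩).symm)
    (w := fun _ _ => 1) measurable_const hf n 1 (fun _ => s) (fun _ => ⟨hs, le_rfl⟩)
    (Ψ := fun z y => f (z 0) * φ (z 0 + y)) (by simp only [Function.uncurry_def]; fun_prop)
  simp only [one_mul, add_sub_cancel] at h
  rw [h, hL.stationary s t hs.le hst, lintegral_map _ (hL.measurable _)]
  refine Measurable.lintegral_prod_right'
    (f := fun z : ℝ × Ω => (∫⁻ u in Set.Ioc 0 s, f (Y u z.2)) ^ n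
        * (f (Y s z.2) * φ (Y s z.2 + z.1))) ?_
  have h1 : Measurable fun ω => ∫⁻ u in Set.Ioc 0 s, f (Y u ω) :=
    (measurable_lintegral_Ioc hY hf).comp (measurable_const.prodMk measurable_id)
  have h2 := hL.measurable s
  fun_prop

lemma lintegral_pow_occupation (hY : Measurable (Function.uncurry Y)) (hL : IsLevyProcess P Y)
    (hθ : 0 < θ) {A : Set ℝ} (hA : MeasurableSet A) {g : ℕ → Measure ℝ} [∀ n, SFinite (g n)]
    (hg0 : g 0 = Measure.dirac 0)
    (hg : ∀ n, g (n + 1) = (Measure.conv (g n) (sampledLaw P Y θ)).restrict A)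
    (n : ℕ) {φ : ℝ → ℝ≥0∞} (hφ : Measurable φ) :
    ∫⁻ t, ∫⁻ ω, (∫⁻ u in Set.Ioc 0 t, ENNReal.ofReal θ * A.indicator 1 (Y u ω)) ^ n
        * φ (Y t ω) ∂P ∂(expMeasure θ)
      = n.factorial * ∫⁻ x, ∫⁻ y, φ (x + y) ∂(sampledLaw P Y θ) ∂(g n) := by
  have := isProbabilityMeasure_sampledLaw (P := P) hY hθ
  have := isProbabilityMeasure_expMeasure hθ
  set m := sampledLaw P Y θ with hm
  have hYt : ∀ t, Measurable (Y t) := hL.measurable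
  have hi1 : Measurable (A.indicator (1 : ℝ → ℝ≥0∞)) := measurable_one.indicator hA
  have hφm : Measurable fun x => ∫⁻ y, φ (x + y) ∂m :=
    Measurable.lintegral_prod_right' (f := fun z : ℝ × ℝ => φ (z.1 + z.2)) (by fun_prop)
  induction n generalizing φ with
  | zero =>
    simp only [pow_zero, one_mul, Nat.factorial_zero, Nat.cast_one, hg0]
    rw [lintegral_dirac' _ hφm, hm, lintegral_sampledLaw hY (by fun_prop)]
    simp
  | succ n ih =>
    set f : ℝ → ℝ≥0∞ := fun x => ENNReal.ofReal θ * A.indicator 1 x with hf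
    have hfm : Measurable f := by fun_prop
    have hB := measurable_lintegral_Ioc hY hfm
    have hexp : ∀ t ω, (∫⁻ u in Set.Ioc 0 t, f (Y u ω)) ^ (n + 1) * φ (Y t ω)
        = (n + 1 : ℝ≥0∞) * ∫⁻ s in Set.Ioc 0 t,
          (∫⁻ u in Set.Ioc 0 s, f (Y u ω)) ^ n * (f (Y s ω) * φ (Y t ω)) := by
      intro t ω
      have h1 : Measurable fun u => f (Y u ω) := hfm.comp (hY.comp measurable_prodMk_right)
      have h2 : Measurable fun s => ∫⁻ u in Set.Ioc 0 s, f (Y u ω) :=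
        hB.comp measurable_prodMk_right
      have h3 : Measurable fun s => f (Y s ω) * (∫⁻ u in Set.Ioc 0 s, f (Y u ω)) ^ n :=
        h1.mul (h2.pow_const n)
      rw [lintegral_Ioc_pow_succ h1, mul_assoc, ← lintegral_mul_const _ h3]
      congr 1
      refine lintegral_congr fun s => by ring
    set Q : ℝ → ℝ → ℝ≥0∞ := fun s y => ∫⁻ ω, (∫⁻ u in Set.Ioc 0 s, f (Y u ω)) ^ n
        * (A.indicator 1 (Y s ω) * φ (Y s ω + y)) ∂P with hQ
    have hQm : Measurable (Function.uncurry Q) := by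
      refine Measurable.lintegral_prod_right' (f := fun z : (ℝ × ℝ) × Ω =>
        (∫⁻ u in Set.Ioc 0 z.1.1, f (Y u z.2)) ^ n
          * (A.indicator 1 (Y z.1.1 z.2) * φ (Y z.1.1 z.2 + z.1.2))) ?_
      have h1 : Measurable fun z : (ℝ × ℝ) × Ω => ∫⁻ u in Set.Ioc 0 z.1.1, f (Y u z.2) :=
        hB.comp (by fun_prop : Measurable fun z : (ℝ × ℝ) × Ω => (z.1.1, z.2))
      have h2 : Measurable fun z : (ℝ × ℝ) × Ω => Y z.1.1 z.2 :=
        hY.comp (by fun_prop : Measurable fun z : (ℝ × ℝ) × Ω => (z.1.1, z.2))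
      fun_prop
    have hinner : ∀ t ∈ Set.Ioi (0 : ℝ), ENNReal.ofReal (θ * Real.exp (-θ * t))
        * ∫⁻ ω, (∫⁻ u in Set.Ioc 0 t, f (Y u ω)) ^ (n + 1) * φ (Y t ω) ∂P
        = (n + 1 : ℝ≥0∞) * ∫⁻ s in Set.Ioc 0 t, ENNReal.ofReal (θ * Real.exp (-θ * t))
          * (ENNReal.ofReal θ * ∫⁻ ω', Q s (Y (t - s) ω') ∂P) := by
      intro t _
      have hm3 : Measurable fun z : Ω × ℝ =>
          (∫⁻ u in Set.Ioc 0 z.2, f (Y u z.1)) ^ n * (f (Y z.2 z.1) * φ (Y t z.1)) := by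
        have h1 : Measurable fun z : Ω × ℝ => ∫⁻ u in Set.Ioc 0 z.2, f (Y u z.1) :=
          hB.comp measurable_swap
        have h2 : Measurable fun z : Ω × ℝ => Y z.2 z.1 := hY.comp measurable_swap
        have h3 := hYt t
        fun_prop
      simp_rw [hexp]
      rw [lintegral_const_mul _ (Measurable.lintegral_prod_right' hm3), mul_left_comm,
        lintegral_lintegral_swap hm3.aemeasurable,
        ← lintegral_const_mul _ (Measurable.lintegral_prod_left' hm3)]
      congr 1
      refine setLIntegral_congr_fun measurableSet_Ioc fun s hs => ?_
      simp only
      rw [lintegral_increment hY hL hfm hφ n hs.1 hs.2]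
      congr 1
      have h4 : Measurable fun ω' => Q s (Y (t - s) ω') :=
        hQm.comp (measurable_const.prodMk (hYt _))
      rw [← lintegral_const_mul _ h4]
      refine lintegral_congr fun ω' => ?_
      rw [hQ]
      simp only
      rw [← lintegral_const_mul' _ _ ENNReal.ofReal_ne_top]
      refine lintegral_congr fun ω => ?_
      simp only [hf]; ring
    have hF : Measurable (Function.uncurry fun s t : ℝ => ENNReal.ofReal (θ * Real.exp (-θ * t))
          * (ENNReal.ofReal θ * ∫⁻ ω', Q s (Y (t - s) ω') ∂P)) := by
      have h1 : Measurable fun p : ℝ × ℝ => ∫⁻ ω', Q p.1 (Y (p.2 - p.1) ω') ∂P := by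
        refine Measurable.lintegral_prod_right' (f := fun z : (ℝ × ℝ) × Ω =>
          Q z.1.1 (Y (z.1.2 - z.1.1) z.2)) ?_
        have h2 : Measurable fun z : (ℝ × ℝ) × Ω => Y (z.1.2 - z.1.1) z.2 :=
          hY.comp (by fun_prop : Measurable fun z : (ℝ × ℝ) × Ω => (z.1.2 - z.1.1, z.2))
        exact hQm.comp ((measurable_fst.comp measurable_fst).prodMk h2)
      simp only [Function.uncurry_def]
      fun_prop
    have hQs : ∀ s, Measurable (Q s) := fun s => hQm.comp measurable_prodMk_left
    have hshift : ∀ s, ∫⁻ r in Set.Ioi 0, ENNReal.ofReal (θ * Real.exp (-θ * (s + r)))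
          * (ENNReal.ofReal θ * ∫⁻ ω', Q s (Y (s + r - s) ω') ∂P)
        = ENNReal.ofReal (θ * Real.exp (-θ * s)) * ∫⁻ y, Q s y ∂m := by
      intro s
      have h1 : Measurable fun r => ∫⁻ ω', Q s (Y r ω') ∂P :=
        Measurable.lintegral_prod_right' (f := fun z : ℝ × Ω => Q s (Y z.1 z.2)) ((hQs s).comp hY)
      rw [hm, lintegral_sampledLaw hY (hQs s), lintegral_expMeasure _ h1,
        ← lintegral_const_mul' _ _ ENNReal.ofReal_ne_top]
      refine lintegral_congr fun r => ?_
      rw [add_sub_cancel_left, ← mul_assoc, ← mul_assoc, ← ENNReal.ofReal_mul (by positivity),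
        ← ENNReal.ofReal_mul (by positivity), mul_add, Real.exp_add]
      congr 2; ring
    have hQint : ∀ s, ∫⁻ y, Q s y ∂m = ∫⁻ ω, (∫⁻ u in Set.Ioc 0 s, f (Y u ω)) ^ n
        * A.indicator (fun x => ∫⁻ y, φ (x + y) ∂m) (Y s ω) ∂P := by
      intro s
      have h1 : Measurable fun ω => ∫⁻ u in Set.Ioc 0 s, f (Y u ω) :=
        hB.comp measurable_prodMk_left
      have h2 := hYt s
      rw [hQ, lintegral_lintegral_swap (by
        simp only [Function.uncurry_def]
        exact Measurable.aemeasurable (by fun_prop))]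
      refine lintegral_congr fun ω => ?_
      rw [lintegral_const_mul _ (by fun_prop), lintegral_const_mul _ (by fun_prop)]
      by_cases h : Y s ω ∈ A <;> simp [h]
    have hleft : Measurable fun t => ∫⁻ ω, (∫⁻ u in Set.Ioc 0 t, f (Y u ω)) ^ (n + 1)
        * φ (Y t ω) ∂P :=
      Measurable.lintegral_prod_right' (f := fun z : ℝ × Ω =>
        (∫⁻ u in Set.Ioc 0 z.1, f (Y u z.2)) ^ (n + 1) * φ (Y z.1 z.2))
        ((hB.pow_const _).mul (hφ.comp hY))
    have hψm : Measurable (A.indicator fun x => ∫⁻ y, φ (x + y) ∂m) := hφm.indicator hA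
    have hright : Measurable fun t => ∫⁻ ω, (∫⁻ u in Set.Ioc 0 t, f (Y u ω)) ^ n
        * A.indicator (fun x => ∫⁻ y, φ (x + y) ∂m) (Y t ω) ∂P :=
      Measurable.lintegral_prod_right' (f := fun z : ℝ × Ω =>
        (∫⁻ u in Set.Ioc 0 z.1, f (Y u z.2)) ^ n
          * A.indicator (fun x => ∫⁻ y, φ (x + y) ∂m) (Y z.1 z.2))
        ((hB.pow_const _).mul (hψm.comp hY))
    rw [lintegral_expMeasure _ hleft, setLIntegral_congr_fun measurableSet_Ioi hinner,
      lintegral_const_mul' _ _ (by finiteness), lintegral_Ioi_Ioc_eq hF]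
    simp_rw [hshift, hQint]
    rw [← lintegral_expMeasure _ hright, ih hψm (Measurable.lintegral_prod_right'
        (f := fun z : ℝ × ℝ => A.indicator (fun x => ∫⁻ y, φ (x + y) ∂m) (z.1 + z.2))
        (by fun_prop)), hg, ← lintegral_indicator hA, Measure.lintegral_conv hψm,
      ← mul_assoc]
    congr 1
    rw [Nat.factorial_succ]; push_cast; rfl

end Resolvent

section Modification

open scoped ENNReal Topology

variable {P : Measure Ω} {X Y : ℝ → Ω → ℝ}

lemma measurable_uncurry_of_rightContinuous (hY : ∀ t, Measurable (Y t))
    (hc : ∀ ω t, ContinuousWithinAt (fun s => Y s ω) (Set.Ici t) t) :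
    Measurable (Function.uncurry Y) := by
  set τ : ℕ → ℝ → ℝ := fun n t => ((⌊((n : ℝ) + 1) * t⌋ : ℝ) + 1) / ((n : ℝ) + 1) with hτ
  have hle : ∀ n t, t ≤ τ n t := fun n t => by
    rw [hτ]; simp only
    rw [le_div_iff₀ (by positivity)]
    linarith [Int.lt_floor_add_one (((n : ℝ) + 1) * t)]
  have hge : ∀ n t, τ n t ≤ t + 1 / ((n : ℝ) + 1) := fun n t => by
    rw [hτ]; simp only
    have hn : (0 : ℝ) < (n : ℝ) + 1 := by positivity
    rw [div_le_iff₀ hn, add_mul t, one_div_mul_cancel hn.ne']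
    linarith [Int.floor_le (((n : ℝ) + 1) * t)]
  refine measurable_of_tendsto_metrizable (f := fun n (p : ℝ × Ω) => Y (τ n p.1) p.2)
    (fun n => ?_) (tendsto_pi_nhds.2 fun p => ?_)
  · have h : Measurable fun z : ℤ × Ω => Y (((z.1 : ℝ) + 1) / ((n : ℝ) + 1)) z.2 :=
      measurable_from_prod_countable_right fun k => hY (((k : ℝ) + 1) / ((n : ℝ) + 1))
    exact h.comp (by fun_prop : Measurable fun p : ℝ × Ω => (⌊((n : ℝ) + 1) * p.1⌋, p.2))
  · refine (hc p.2 p.1).tendsto.comp (tendsto_nhdsWithin_iff.2 ⟨?_, .of_forall fun n => hle n _⟩)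
    refine tendsto_of_tendsto_of_tendsto_of_le_of_le tendsto_const_nhds ?_
      (fun n => hle n p.1) (fun n => hge n p.1)
    simpa using tendsto_const_nhds.add (tendsto_one_div_add_atTop_nhds_zero_nat (𝕜 := ℝ))

lemma IsLevyProcess.congr (hX : IsLevyProcess P X) (hY : ∀ t, Measurable (Y t))
    (hYX : ∀ᵐ ω ∂P, ∀ t, 0 ≤ t → Y t ω = X t ω) : IsLevyProcess P Y := by
  have hae : ∀ t, 0 ≤ t → X t =ᵐ[P] Y t := fun t ht => by
    filter_upwards [hYX] with ω h using (h t ht).symm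
  refine ⟨hY, ?_, ?_, fun s t hs hst => ?_, fun s t hs hst n u hu => ?_⟩
  · filter_upwards [hYX, hX.start] with ω h h0
    rw [h 0 le_rfl, h0]
  · filter_upwards [hYX, hX.cadlag] with ω h hc t ht
    refine ⟨(hc t ht).1.congr (fun s hs => h s (ht.trans hs)) (h t ht), fun ht0 => ?_⟩
    obtain ⟨l, hl⟩ := (hc t ht).2 ht0
    refine ⟨l, hl.congr' ?_⟩
    filter_upwards [mem_nhdsWithin_of_mem_nhds (Ioi_mem_nhds ht0)] with s hs
    exact (h s (le_of_lt hs)).symm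
  · rw [← Measure.map_congr (hae (t - s) (sub_nonneg.2 hst)), ← hX.stationary s t hs hst]
    refine Measure.map_congr ?_
    filter_upwards [hae s hs, hae t (hs.trans hst)] with ω h1 h2
    rw [h1, h2]
  · refine (hX.indep s t hs hst n u hu).congr ?_ ?_
    · filter_upwards [hae s hs, hae t (hs.trans hst)] with ω h1 h2
      rw [h1, h2]
    · filter_upwards [hYX] with ω h
      funext i
      exact (h _ (hu i).1).symm

lemma IsLevyProcess.exists_measurable_modification (hX : IsLevyProcess P X) :
    ∃ Y : ℝ → Ω → ℝ, Measurable (Function.uncurry Y) ∧ IsLevyProcess P Y ∧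
      ∀ᵐ ω ∂P, ∀ t, 0 ≤ t → Y t ω = X t ω := by
  classical
  obtain ⟨G, hG, hGm, hGc⟩ := hX.cadlag.exists_measurable_mem
  set Y : ℝ → Ω → ℝ := fun t ω => if ω ∈ G then X (max t 0) ω else 0 with hYdef
  have hY : ∀ t, Measurable (Y t) := fun t =>
    Measurable.ite hGm (hX.measurable _) measurable_const
  have hYX : ∀ᵐ ω ∂P, ∀ t, 0 ≤ t → Y t ω = X t ω := by
    filter_upwards [hG] with ω hω t ht
    simp [hYdef, hω, ht]
  refine ⟨Y, measurable_uncurry_of_rightContinuous hY fun ω t => ?_, hX.congr hY hYX, hYX⟩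
  by_cases hω : ω ∈ G
  · simp only [hYdef, hω, if_true]
    exact ContinuousWithinAt.comp (g := fun s => X s ω) (f := fun s => max s 0)
      (t := Set.Ici (max t 0)) (hGc ω hω _ (le_max_right _ _)).1
      (by fun_prop) fun s hs => Set.mem_Ici.2 (max_le_max_right 0 hs)
  · simp only [hYdef, hω, if_false]
    exact continuousWithinAt_const

end Modification
section Laplace

open scoped ENNReal

variable {P : Measure Ω} [IsProbabilityMeasure P] {Y : ℝ → Ω → ℝ} {E : Ω → ℝ} {q lam θ : ℝ}

lemma integrableOn_pos_ite (hY : Measurable (Function.uncurry Y)) (t : ℝ) (ω : Ω) :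
    IntegrableOn (fun s => if 0 < Y s ω then (1 : ℝ) else 0) (Set.Ioc 0 t) := by
  have h : Measurable fun s => Y s ω := hY.comp measurable_prodMk_right
  refine Measure.integrableOn_of_bounded (M := 1) (by simp)
    (Measurable.ite (measurableSet_lt measurable_const h) measurable_const
      measurable_const).aestronglyMeasurable (.of_forall fun s => ?_)
  split_ifs <;> simp

lemma sojourn_nonneg {α : Type*} (X : ℝ → α → ℝ) {t : ℝ} (ht : 0 ≤ t) (ω : α) : 0 ≤ sojourn X t ω :=
  intervalIntegral.integral_nonneg ht fun s _ => by split_ifs <;> simp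

lemma sojourn_congr {α : Type*} {X Y : ℝ → α → ℝ} {ω : α} (h : ∀ t, 0 ≤ t → Y t ω = X t ω) {t : ℝ}
    (ht : 0 ≤ t) : sojourn Y t ω = sojourn X t ω := by
  refine intervalIntegral.integral_congr fun s hs => ?_
  rw [Set.uIcc_of_le ht] at hs
  simp only [h s hs.1]

lemma sojourn_le (hY : Measurable (Function.uncurry Y)) {t : ℝ} (ht : 0 ≤ t) (ω : Ω) :
    sojourn Y t ω ≤ t := by
  have h : sojourn Y t ω ≤ ∫ _ in (0 : ℝ)..t, (1 : ℝ) := by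
    rw [sojourn, intervalIntegral.integral_of_le ht, intervalIntegral.integral_of_le ht]
    exact setIntegral_mono (integrableOn_pos_ite hY t ω) (by simp) fun s => by
      simp only; split_ifs <;> simp
  simpa using h

lemma lintegral_occupation_eq (hY : Measurable (Function.uncurry Y)) (hθ : 0 ≤ θ) {t : ℝ}
    (ht : 0 ≤ t) (ω : Ω) :
    ∫⁻ u in Set.Ioc 0 t, ENNReal.ofReal θ * (Set.Iic 0).indicator 1 (Y u ω)
      = ENNReal.ofReal (θ * (t - sojourn Y t ω)) := by
  have hi := integrableOn_pos_ite hY t ω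
  have h1 : ∫ u in Set.Ioc 0 t, θ * (1 - if 0 < Y u ω then (1 : ℝ) else 0)
      = θ * (t - sojourn Y t ω) := by
    rw [integral_const_mul, integral_sub (by simp) hi, sojourn,
      intervalIntegral.integral_of_le ht]
    simp [ht]
  rw [← h1, ofReal_integral_eq_lintegral_ofReal]
  · refine lintegral_congr fun u => ?_
    rw [ENNReal.ofReal_mul hθ]
    by_cases h : 0 < Y u ω
    · simp [h]
    · simp [h, not_lt.1 h]
  · exact ((integrable_const (1 : ℝ)).sub hi).const_mul θ
  · refine .of_forall fun u => mul_nonneg hθ ?_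
    split_ifs <;> simp

lemma ofReal_exp_eq_tsum {x : ℝ} (hx : 0 ≤ x) :
    ENNReal.ofReal (Real.exp x) = ∑' n : ℕ, ENNReal.ofReal (x ^ n / n.factorial) := by
  rw [← ENNReal.ofReal_tsum_of_nonneg (fun n => by positivity) (Real.summable_pow_div_factorial x),
    Real.exp_eq_exp_ℝ, NormedSpace.exp_eq_tsum_div]

lemma ofReal_exp_sojourn (hY : Measurable (Function.uncurry Y)) (hq : 0 < q) (hlam : 0 < lam)
    {t : ℝ} (ht : 0 ≤ t) (ω : Ω) :
    ENNReal.ofReal (Real.exp (-lam * sojourn Y t ω))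
      = ∑' n : ℕ, ENNReal.ofReal ((lam / (q + lam)) ^ n / n.factorial)
        * ((∫⁻ u in Set.Ioc 0 t, ENNReal.ofReal (q + lam) * (Set.Iic 0).indicator 1 (Y u ω)) ^ n
        * ENNReal.ofReal (Real.exp (-lam * t))) := by
  have hθ : 0 < q + lam := by positivity
  have hle := sojourn_le hY ht ω
  have h0 : 0 ≤ lam * (t - sojourn Y t ω) := mul_nonneg hlam.le (sub_nonneg.2 hle)
  rw [show -lam * sojourn Y t ω = lam * (t - sojourn Y t ω) + -lam * t by ring, Real.exp_add,
    ENNReal.ofReal_mul (by positivity), ofReal_exp_eq_tsum h0, ← ENNReal.tsum_mul_right]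
  refine tsum_congr fun n => ?_
  rw [lintegral_occupation_eq hY hθ.le ht, ← mul_assoc, ← ENNReal.ofReal_pow
    (mul_nonneg hθ.le (sub_nonneg.2 hle))]
  congr 1
  rw [← ENNReal.ofReal_mul (by positivity), div_mul_eq_mul_div, ← mul_pow]
  congr 3
  field_simp

lemma lintegral_pow_occupation_exponential (hY : Measurable (Function.uncurry Y))
    (hL : IsLevyProcess P Y) (hq : 0 < q) (hlam : 0 < lam) (hE : Measurable E)
    (hEdist : P.map E = expMeasure q)
    (hind : ∀ (k : ℕ) (v : Fin k → ℝ), (∀ i, 0 < v i) →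
      IndepFun (fun ω i => Y (v i) ω) E P) (n : ℕ) :
    ∫⁻ ω, (∫⁻ u in Set.Ioc 0 (E ω), ENNReal.ofReal (q + lam)
        * (Set.Iic 0).indicator 1 (Y u ω)) ^ n * ENNReal.ofReal (Real.exp (-lam * E ω)) ∂P
      = ENNReal.ofReal (q / (q + lam)) * (n.factorial
        * negWalk (sampledLaw P Y (q + lam)) n Set.univ) := by
  have hθ : 0 < q + lam := by positivity
  have := isProbabilityMeasure_sampledLaw (P := P) hY hθ
  have hi1 : Measurable ((Set.Iic 0).indicator (1 : ℝ → ℝ≥0∞)) :=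
    measurable_one.indicator measurableSet_Iic
  set f : ℝ → ℝ≥0∞ := fun x => ENNReal.ofReal (q + lam) * (Set.Iic 0).indicator 1 x with hf
  have hfm : Measurable f := by fun_prop
  have hB := measurable_lintegral_Ioc hY hfm
  have hw : ∀ y ω, ∫⁻ u in Set.Ioi 0, {p : ℝ × ℝ | p.1 ≤ p.2}.indicator 1 (u, y) * f (Y u ω)
      = ∫⁻ u in Set.Ioc 0 y, f (Y u ω) := by
    intro y ω
    have : ∀ u, {p : ℝ × ℝ | p.1 ≤ p.2}.indicator 1 (u, y) * f (Y u ω)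
        = (Set.Iic y).indicator (fun u => f (Y u ω)) u := fun u => by
      by_cases h : u ≤ y <;> simp [h]
    simp_rw [this]
    rw [lintegral_indicator measurableSet_Iic, Measure.restrict_restrict measurableSet_Iic,
      Set.Iic_inter_Ioi]
  have h := lintegral_pow_mul_of_indepFun (P := P) hY hE (S := Set.Ioi 0) measurableSet_Ioi
    (fun k v hv => hind k v hv)
    (w := fun u y => {p : ℝ × ℝ | p.1 ≤ p.2}.indicator 1 (u, y))
    (measurable_one.indicator (measurableSet_le measurable_fst measurable_snd)) hfm n 0
    (fun i => i.elim0) (fun i => i.elim0)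
    (Ψ := fun _ y => ENNReal.ofReal (Real.exp (-lam * y)))
    (by simp only [Function.uncurry_def]; fun_prop)
  simp only [hw] at h
  have hm1 : Measurable fun p : ℝ × Ω => (∫⁻ u in Set.Ioc 0 p.1, f (Y u p.2)) ^ n :=
    hB.pow_const n
  have hm2 : Measurable fun y => ∫⁻ ω, (∫⁻ u in Set.Ioc 0 y, f (Y u ω)) ^ n ∂P :=
    hm1.lintegral_prod_right'
  rw [h, hEdist]
  have hc : ∀ y, ∫⁻ ω, (∫⁻ u in Set.Ioc 0 y, f (Y u ω)) ^ n
      * ENNReal.ofReal (Real.exp (-lam * y)) ∂P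
      = (∫⁻ ω, (∫⁻ u in Set.Ioc 0 y, f (Y u ω)) ^ n ∂P)
        * ENNReal.ofReal (Real.exp (-lam * y)) := fun y =>
    lintegral_mul_const' _ _ ENNReal.ofReal_ne_top
  simp_rw [hc]
  have hocc := lintegral_pow_occupation hY hL hθ (A := Set.Iic 0) measurableSet_Iic
    (g := negWalk (sampledLaw P Y (q + lam))) rfl (fun _ => rfl) n (φ := fun _ => 1)
    measurable_const
  simp only [mul_one, lintegral_const, measure_univ, one_mul] at hocc
  rw [← hocc, lintegral_expMeasure _ (by fun_prop), lintegral_expMeasure _ hm2,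
    ← lintegral_const_mul' _ _ ENNReal.ofReal_ne_top]
  refine lintegral_congr fun t => ?_
  rw [mul_comm (∫⁻ _, _ ∂P), ← mul_assoc, ← mul_assoc, ← ENNReal.ofReal_mul (by positivity),
    ← ENNReal.ofReal_mul (by positivity)]
  congr 2
  rw [show -(q + lam) * t = -q * t + -lam * t by ring, Real.exp_add]
  field_simp

lemma lintegral_exp_sojourn (hY : Measurable (Function.uncurry Y))
    (hL : IsLevyProcess P Y) (hq : 0 < q) (hlam : 0 < lam) (hE : Measurable E)
    (hEdist : P.map E = expMeasure q)
    (hind : ∀ (k : ℕ) (v : Fin k → ℝ), (∀ i, 0 < v i) →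
      IndepFun (fun ω i => Y (v i) ω) E P) (hE0 : ∀ᵐ ω ∂P, 0 ≤ E ω) :
    ∫⁻ ω, ENNReal.ofReal (Real.exp (-lam * sojourn Y (E ω) ω)) ∂P
      = ENNReal.ofReal (q / (q + lam) * ∑' n : ℕ,
        (negWalk (sampledLaw P Y (q + lam)) n).real Set.univ * (lam / (q + lam)) ^ n) := by
  have hθ : 0 < q + lam := by positivity
  have := isProbabilityMeasure_sampledLaw (P := P) hY hθ
  set m := sampledLaw P Y (q + lam) with hm
  have hs : lam / (q + lam) < 1 := by rw [div_lt_one hθ]; linarith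
  have hi1 : Measurable ((Set.Iic 0).indicator (1 : ℝ → ℝ≥0∞)) :=
    measurable_one.indicator measurableSet_Iic
  have hB : Measurable fun ω => ∫⁻ u in Set.Ioc 0 (E ω), ENNReal.ofReal (q + lam)
      * (Set.Iic 0).indicator 1 (Y u ω) :=
    (measurable_lintegral_Ioc hY (f := fun x => ENNReal.ofReal (q + lam)
      * (Set.Iic 0).indicator 1 x) (by fun_prop)).comp (hE.prodMk measurable_id)
  have hp : ∀ n, (negWalk m n).real Set.univ ≤ 1 := fun n =>
    ENNReal.toReal_le_of_le_ofReal zero_le_one (by simpa using negWalk_univ_le_one m n)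
  rw [lintegral_congr_ae (hE0.mono fun ω hω => ofReal_exp_sojourn hY hq hlam hω ω),
    lintegral_tsum fun n => Measurable.aemeasurable (by fun_prop), ← tsum_mul_left,
    ENNReal.ofReal_tsum_of_nonneg (fun n => by positivity)
      (((summable_geometric_of_lt_one (by positivity) hs).of_nonneg_of_le
        (fun n => by positivity)
        fun n => mul_le_of_le_one_left (by positivity) (hp n)).mul_left _)]
  refine tsum_congr fun n => ?_
  rw [lintegral_const_mul' _ _ ENNReal.ofReal_ne_top,
    lintegral_pow_occupation_exponential hY hL hq hlam hE hEdist hind,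
    ← ofReal_measureReal (μ := negWalk _ n) (s := Set.univ), ← ENNReal.ofReal_natCast,
    ← ENNReal.ofReal_mul (by positivity), ← ENNReal.ofReal_mul (by positivity),
    ← ENNReal.ofReal_mul (by positivity)]
  congr 1
  field_simp
  rfl

lemma lintegral_levyExponent (hY : Measurable (Function.uncurry Y))
    (hL : IsLevyProcess P Y) (hq : 0 < q) (hlam : 0 < lam) :
    ∫⁻ t in Set.Ioi (0 : ℝ), ENNReal.ofReal (Real.exp (-q * t) * t⁻¹ * P.real {ω | 0 < Y t ω}
        * (1 - Real.exp (-lam * t)))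
      = ∑' n : ℕ, ENNReal.ofReal ((lam / (q + lam)) ^ (n + 1) / (n + 1)
        * (convNPow (sampledLaw P Y (q + lam)) (n + 1)).real (Set.Ioi 0)) := by
  have hθ : 0 < q + lam := by positivity
  have := isProbabilityMeasure_sampledLaw (P := P) hY hθ
  set m := sampledLaw P Y (q + lam) with hm
  have hi1 : Measurable ((Set.Ioi 0).indicator (1 : ℝ → ℝ≥0∞)) :=
    measurable_one.indicator measurableSet_Ioi
  have hPY : ∀ t, ∫⁻ ω, (Set.Ioi 0).indicator (1 : ℝ → ℝ≥0∞) (Y t ω) ∂P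
      = ENNReal.ofReal (P.real {ω | 0 < Y t ω}) := fun t => by
    rw [ofReal_measureReal, ← lintegral_indicator_one
      (measurableSet_lt measurable_const (hL.measurable t))]
    rfl
  have hmeas : Measurable fun t => ENNReal.ofReal (P.real {ω | 0 < Y t ω}) := by
    simp_rw [← hPY]
    exact Measurable.lintegral_prod_right'
      (f := fun z : ℝ × Ω => (Set.Ioi 0).indicator (1 : ℝ → ℝ≥0∞) (Y z.1 z.2)) (hi1.comp hY)
  have hterm : ∀ n : ℕ, ENNReal.ofReal ((lam / (q + lam)) ^ (n + 1) / (n + 1)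
        * (convNPow m (n + 1)).real (Set.Ioi 0))
      = ∫⁻ t in Set.Ioi (0 : ℝ), ENNReal.ofReal (Real.exp (-(q + lam) * t) * t⁻¹
        * ((lam * t) ^ (n + 1) / (n + 1).factorial)) * ENNReal.ofReal (P.real {ω | 0 < Y t ω}) := by
    intro n
    have hocc := lintegral_pow_occupation hY hL hθ (A := Set.univ) MeasurableSet.univ
      (g := convNPow m) rfl (fun _ => by simp [convNPow, hm]) n hi1
    rw [← Measure.lintegral_conv hi1, lintegral_indicator_one measurableSet_Ioi] at hocc
    change _ = n.factorial * convNPow m (n + 1) (Set.Ioi 0) at hocc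
    simp only [Set.indicator_univ, Pi.one_apply, mul_one, setLIntegral_const, Real.volume_Ioc,
      sub_zero] at hocc
    have hc : ∀ t, ∫⁻ ω, (ENNReal.ofReal (q + lam) * ENNReal.ofReal t) ^ n
        * (Set.Ioi 0).indicator 1 (Y t ω) ∂P
        = (ENNReal.ofReal (q + lam) * ENNReal.ofReal t) ^ n
          * ENNReal.ofReal (P.real {ω | 0 < Y t ω}) := fun t => by
      rw [lintegral_const_mul' _ _ (by finiteness), hPY]
    simp_rw [hc] at hocc
    rw [lintegral_expMeasure _ (by fun_prop)] at hocc
    have hfac : (convNPow m (n + 1)) (Set.Ioi 0) = ENNReal.ofReal ((n.factorial : ℝ)⁻¹)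
        * (n.factorial * convNPow m (n + 1) (Set.Ioi 0)) := by
      rw [← mul_assoc, ← ENNReal.ofReal_natCast, ← ENNReal.ofReal_mul (by positivity),
        inv_mul_cancel₀ (by positivity), ENNReal.ofReal_one, one_mul]
    rw [ENNReal.ofReal_mul (by positivity), ofReal_measureReal, hfac, ← hocc, ← mul_assoc,
      ← ENNReal.ofReal_mul (by positivity), ← lintegral_const_mul' _ _ ENNReal.ofReal_ne_top]
    refine setLIntegral_congr_fun measurableSet_Ioi fun t ht => ?_
    have ht : 0 < t := ht
    rw [← mul_assoc, ← mul_assoc, ← ENNReal.ofReal_mul (by positivity),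
      ← ENNReal.ofReal_mul hθ.le, ← ENNReal.ofReal_pow (by positivity),
      ← ENNReal.ofReal_mul (by positivity)]
    congr 2
    rw [Nat.factorial_succ]
    push_cast
    rw [div_pow, mul_pow, mul_pow, pow_succ (q + lam), pow_succ t]
    field_simp
  simp_rw [hterm]
  rw [← lintegral_tsum fun n => Measurable.aemeasurable (by fun_prop)]
  refine setLIntegral_congr_fun measurableSet_Ioi fun t ht => ?_
  have ht : 0 < t := ht
  rw [ENNReal.tsum_mul_right, ← ENNReal.ofReal_tsum_of_nonneg (fun n => by positivity)
    (((summable_nat_add_iff 1).2 (Real.summable_pow_div_factorial (lam * t))).mul_left _),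
    tsum_mul_left, ← ENNReal.ofReal_mul
      (mul_nonneg (by positivity) (tsum_nonneg fun n => by positivity))]
  congr 1
  have hsum : ∑' n : ℕ, (lam * t) ^ (n + 1) / (n + 1).factorial = Real.exp (lam * t) - 1 := by
    rw [Real.exp_eq_exp_ℝ, NormedSpace.exp_eq_tsum_div]
    beta_reduce
    rw [(Real.summable_pow_div_factorial (lam * t)).tsum_eq_zero_add]
    simp
  have h1 : Real.exp (-lam * t) * Real.exp (lam * t) = 1 := by
    rw [← Real.exp_add]; simp
  rw [hsum, show -(q + lam) * t = -q * t + -lam * t by ring, Real.exp_add]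
  linear_combination (-Real.exp (-q * t) * t⁻¹ * P.real {ω | 0 < Y t ω}) * h1

lemma hasSum_levyExponent (hY : Measurable (Function.uncurry Y))
    (hL : IsLevyProcess P Y) (hq : 0 < q) (hlam : 0 < lam) :
    IntegrableOn (fun t => Real.exp (-q * t) * t⁻¹ * P.real {ω | 0 < Y t ω}
        * (1 - Real.exp (-lam * t))) (Set.Ioi 0) ∧
      HasSum (fun n : ℕ => (lam / (q + lam)) ^ (n + 1) / (n + 1)
        * (convNPow (sampledLaw P Y (q + lam)) (n + 1)).real (Set.Ioi 0))
        (∫ t in Set.Ioi (0 : ℝ), Real.exp (-q * t) * t⁻¹ * P.real {ω | 0 < Y t ω}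
        * (1 - Real.exp (-lam * t))) := by
  have hθ : 0 < q + lam := by positivity
  have := isProbabilityMeasure_sampledLaw (P := P) hY hθ
  have hs : lam / (q + lam) < 1 := by rw [div_lt_one hθ]; linarith
  have hs0 : 0 ≤ lam / (q + lam) := by positivity
  have hsum : Summable fun n : ℕ => (lam / (q + lam)) ^ (n + 1) / (n + 1)
        * (convNPow (sampledLaw P Y (q + lam)) (n + 1)).real (Set.Ioi 0) := by
    refine ((summable_nat_add_iff 1).2 (summable_geometric_of_lt_one hs0 hs)).of_nonneg_of_le
      (fun n => by positivity) fun n => ?_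
    refine (mul_le_of_le_one_right (by positivity) measureReal_le_one).trans
      (div_le_self (by positivity) ?_)
    linarith [n.cast_nonneg (α := ℝ)]
  have hl := lintegral_levyExponent hY hL hq hlam
  rw [← ENNReal.ofReal_tsum_of_nonneg (fun n => by positivity) hsum] at hl
  have hmeas : Measurable fun t => P.real {ω | 0 < Y t ω} := by
    have hm : MeasurableSet {z : ℝ × Ω | 0 < Y z.1 z.2} := measurableSet_lt measurable_const hY
    exact (measurable_measure_prodMk_left hm).ennreal_toReal
  have hnn : 0 ≤ᵐ[volume.restrict (Set.Ioi 0)] fun t => Real.exp (-q * t) * t⁻¹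
      * P.real {ω | 0 < Y t ω} * (1 - Real.exp (-lam * t)) := by
    refine (ae_restrict_mem measurableSet_Ioi).mono fun t ht => ?_
    have ht : 0 < t := ht
    have : Real.exp (-lam * t) ≤ 1 := Real.exp_le_one_iff.2 (by nlinarith)
    exact mul_nonneg (by positivity) (by linarith)
  refine ⟨⟨Measurable.aestronglyMeasurable (by fun_prop), ?_⟩, ?_⟩
  · rw [hasFiniteIntegral_iff_ofReal hnn, hl]
    exact ENNReal.ofReal_lt_top
  · rw [integral_eq_lintegral_of_nonneg_ae hnn (Measurable.aestronglyMeasurable (by fun_prop)), hl,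
      ENNReal.toReal_ofReal (tsum_nonneg fun n => by positivity)]
    exact hsum.hasSum

lemma measurable_sojourn (hY : Measurable (Function.uncurry Y)) (hE : Measurable E) :
    Measurable fun ω => sojourn Y (max (E ω) 0) ω := by
  have h : Measurable fun ω => ∫⁻ u in Set.Ioc 0 (max (E ω) 0),
      ENNReal.ofReal 1 * (Set.Iic 0).indicator 1 (Y u ω) :=
    (measurable_lintegral_Ioc hY (f := fun x => ENNReal.ofReal 1 * (Set.Iic 0).indicator 1 x)
      ((measurable_one.indicator measurableSet_Iic).const_mul _)).comp
      ((hE.max measurable_const).prodMk measurable_id)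
  have hE0 : ∀ ω, 0 ≤ max (E ω) 0 := fun ω => le_max_right _ _
  have heq : ∀ ω, sojourn Y (max (E ω) 0) ω = max (E ω) 0 - (∫⁻ u in Set.Ioc 0 (max (E ω) 0),
      ENNReal.ofReal 1 * (Set.Iic 0).indicator 1 (Y u ω)).toReal := fun ω => by
    rw [lintegral_occupation_eq hY zero_le_one (hE0 ω), one_mul,
      ENNReal.toReal_ofReal (sub_nonneg.2 (sojourn_le hY (hE0 ω) ω))]
    ring
  simp_rw [heq]
  exact (hE.max measurable_const).sub h.ennreal_toReal

lemma integral_exp_sojourn (hY : Measurable (Function.uncurry Y))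
    (hL : IsLevyProcess P Y) (hq : 0 < q) (hlam : 0 < lam) (hE : Measurable E)
    (hEdist : P.map E = expMeasure q)
    (hind : ∀ (k : ℕ) (v : Fin k → ℝ), (∀ i, 0 < v i) →
      IndepFun (fun ω i => Y (v i) ω) E P) (hE0 : ∀ᵐ ω ∂P, 0 ≤ E ω)
    (hA : AEMeasurable (fun ω => sojourn Y (E ω) ω) P) :
    ∫ ω, Real.exp (-lam * sojourn Y (E ω) ω) ∂P
      = Real.exp (- ∫ t in Set.Ioi (0 : ℝ), Real.exp (-q * t) * t⁻¹ * P.real {ω | 0 < Y t ω}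
        * (1 - Real.exp (-lam * t))) := by
  have hθ : 0 < q + lam := by positivity
  have := isProbabilityMeasure_sampledLaw (P := P) hY hθ
  have hs : lam / (q + lam) < 1 := by rw [div_lt_one hθ]; linarith
  have hs0 : 0 ≤ lam / (q + lam) := by positivity
  rw [integral_eq_lintegral_of_nonneg_ae (.of_forall fun ω => by positivity)
    (hA.const_mul _).exp.aestronglyMeasurable, lintegral_exp_sojourn hY hL hq hlam hE hEdist hind hE0,
    ENNReal.toReal_ofReal (mul_nonneg (by positivity) (tsum_nonneg fun n => by positivity))]
  set m := sampledLaw P Y (q + lam) with hm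
  set s := lam / (q + lam) with hs_def
  have hp : ∀ n, |(negWalk m n).real Set.univ| ≤ 1 := fun n => by
    rw [abs_of_nonneg measureReal_nonneg]
    exact ENNReal.toReal_le_of_le_ofReal zero_le_one (by simpa using negWalk_univ_le_one m n)
  have hr : ∀ n, |(convNPow m n).real (Set.Iic 0)| ≤ 1 := fun n => by
    rw [abs_of_nonneg measureReal_nonneg]; exact measureReal_le_one
  have hsum := tsum_mul_pow_eq_exp hp hr (by simp [negWalk]) (nat_mul_negWalk_univ m) hs0 hs
  have hexp := (hasSum_levyExponent hY hL hq hlam).2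
  have hlog := Real.hasSum_pow_div_log_of_abs_lt_one (x := s) (by rwa [abs_of_nonneg hs0])
  have hdiff := (hlog.sub hexp).tsum_eq
  have hr' : ∑' n : ℕ, (convNPow m n).real (Set.Iic 0) / n * s ^ n
      = -Real.log (1 - s) - ∫ t in Set.Ioi (0 : ℝ), Real.exp (-q * t) * t⁻¹
        * P.real {ω | 0 < Y t ω} * (1 - Real.exp (-lam * t)) := by
    have hterm : ∀ n : ℕ, (convNPow m (n + 1)).real (Set.Iic 0) / (n + 1 : ℕ) * s ^ (n + 1)
        = s ^ (n + 1) / (n + 1) - s ^ (n + 1) / (n + 1)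
          * (convNPow m (n + 1)).real (Set.Ioi 0) := fun n => by
      rw [← Set.compl_Iic, probReal_compl_eq_one_sub measurableSet_Iic]
      push_cast; ring
    rw [← hdiff]
    have hsm : Summable fun n : ℕ => (convNPow m n).real (Set.Iic 0) / n * s ^ n := by
      refine (summable_nat_add_iff 1).1 ?_
      exact (hlog.sub hexp).summable.congr fun n => (hterm n).symm
    rw [hsm.tsum_eq_zero_add, Nat.cast_zero, div_zero, zero_mul, zero_add]
    exact tsum_congr hterm
  rw [hsum, hr', Real.exp_sub, Real.exp_neg (Real.log _), Real.exp_log (by linarith),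
    Real.exp_neg]
  have : q / (q + lam) = 1 - s := by rw [hs_def]; field_simp; ring
  rw [this]
  rw [← mul_div_assoc, mul_inv_cancel₀ (by linarith), one_div]

end Laplace
section LaplaceUniqueness

lemma MeasureTheory.Measure.ext_of_forall_integral_pow_eq {μ ν : Measure ℝ} [IsFiniteMeasure μ]
    [IsFiniteMeasure ν] (hμ : ∀ᵐ x ∂μ, |x| ≤ 1) (hν : ∀ᵐ x ∂ν, |x| ≤ 1)
    (h : ∀ n : ℕ, ∫ x, x ^ n ∂μ = ∫ x, x ^ n ∂ν) : μ = ν := by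
  have key : ∀ (ρ : Measure ℝ) [IsFiniteMeasure ρ], (∀ᵐ x ∂ρ, |x| ≤ 1) → ∀ t : ℝ,
      charFun ρ t = ∑' n : ℕ, (t * Complex.I) ^ n / n.factorial * ((∫ x, x ^ n ∂ρ : ℝ) : ℂ) := by
    intro ρ _ hρ t
    have hF : ∀ n : ℕ, Integrable
        (fun x : ℝ => (t * Complex.I) ^ n / n.factorial * ((x ^ n : ℝ) : ℂ)) ρ := fun n => by
      have hi : Integrable (fun x : ℝ => x ^ n) ρ := by
        refine Integrable.of_bound (by fun_prop) 1 (hρ.mono fun x hx => ?_)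
        rw [norm_pow, Real.norm_eq_abs]
        exact pow_le_one₀ (abs_nonneg _) hx
      exact hi.ofReal.const_mul _
    have hnorm : ∀ n : ℕ, ∫ x, ‖(t * Complex.I) ^ n / n.factorial * ((x ^ n : ℝ) : ℂ)‖ ∂ρ
        ≤ |t| ^ n / n.factorial * ρ.real Set.univ := fun n => by
      rw [mul_comm _ (ρ.real _), ← smul_eq_mul (ρ.real _), ← integral_const]
      refine integral_mono_ae (hF n).norm (integrable_const _) (hρ.mono fun x hx => ?_)
      simp only [norm_mul, norm_div, norm_pow, Complex.norm_real, Complex.norm_I, mul_one,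
        Complex.norm_natCast, Real.norm_eq_abs]
      exact mul_le_of_le_one_right (by positivity) (pow_le_one₀ (abs_nonneg _) hx)
    have hs : Summable fun n : ℕ => ∫ x, ‖(t * Complex.I) ^ n / n.factorial
        * ((x ^ n : ℝ) : ℂ)‖ ∂ρ :=
      ((Real.summable_pow_div_factorial |t|).mul_right _).of_nonneg_of_le
        (fun n => integral_nonneg fun x => norm_nonneg _) hnorm
    rw [charFun_apply_real, ← integral_congr_ae (.of_forall fun x => ?_),
      ← (hasSum_integral_of_summable_integral_norm hF hs).tsum_eq]
    · refine tsum_congr fun n => ?_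
      rw [integral_const_mul]
      exact congrArg _ integral_ofReal
    · rw [Complex.exp_eq_exp_ℂ, NormedSpace.exp_eq_tsum_div]
      refine tsum_congr fun n => ?_
      push_cast
      ring
  refine Measure.ext_of_charFun (funext fun t => ?_)
  simp_rw [key μ hμ, key ν hν, h]

lemma MeasureTheory.Measure.ext_of_forall_integral_exp_neg_eq {μ ν : Measure ℝ}
    [IsProbabilityMeasure μ] [IsProbabilityMeasure ν] (hμ : ∀ᵐ x ∂μ, 0 ≤ x)
    (hν : ∀ᵐ x ∂ν, 0 ≤ x)
    (h : ∀ lam : ℝ, 0 < lam → ∫ x, Real.exp (-lam * x) ∂μ = ∫ x, Real.exp (-lam * x) ∂ν) :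
    μ = ν := by
  have hm : Measurable fun x : ℝ => Real.exp (-x) := by fun_prop
  have hb : ∀ (ρ : Measure ℝ), (∀ᵐ x ∂ρ, 0 ≤ x) →
      ∀ᵐ y ∂(ρ.map fun x => Real.exp (-x)), |y| ≤ 1 := fun ρ hρ => by
    rw [ae_map_iff hm.aemeasurable (measurableSet_le (by fun_prop) (by fun_prop))]
    refine hρ.mono fun x hx => ?_
    rw [abs_of_pos (Real.exp_pos _)]
    exact Real.exp_le_one_iff.2 (by linarith)
  have hpow : ∀ (ρ : Measure ℝ) (n : ℕ), ∫ y, y ^ n ∂(ρ.map fun x => Real.exp (-x))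
      = ∫ x, Real.exp (-(n : ℝ) * x) ∂ρ := fun ρ n => by
    rw [integral_map hm.aemeasurable (by fun_prop)]
    refine integral_congr_ae (.of_forall fun x => ?_)
    simp only
    rw [← Real.exp_nat_mul]
    congr 1; ring
  have := Measure.isProbabilityMeasure_map (μ := μ) hm.aemeasurable
  have := Measure.isProbabilityMeasure_map (μ := ν) hm.aemeasurable
  have heq : (μ.map fun x => Real.exp (-x)) = ν.map fun x => Real.exp (-x) := by
    refine Measure.ext_of_forall_integral_pow_eq (hb μ hμ) (hb ν hν) fun n => ?_
    rw [hpow, hpow]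
    rcases n.eq_zero_or_pos with rfl | hn
    · simp
    · exact h n (by exact_mod_cast hn)
  have hinv : ∀ ρ : Measure ℝ,
      (ρ.map fun x => Real.exp (-x)).map (fun y => -Real.log y) = ρ := fun ρ => by
    rw [Measure.map_map (by fun_prop) hm]
    simp [Function.comp_def]
  rw [← hinv μ, heq, hinv]

end LaplaceUniqueness

section CompoundPoisson

open scoped ENNReal

variable {ν : Measure ℝ}

instance sFinite_convNPow [SFinite ν] (n : ℕ) : SFinite (convNPow ν n) := by
  induction n with
  | zero => exact inferInstanceAs (SFinite (Measure.dirac 0))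
  | succ n ih => exact inferInstanceAs (SFinite (Measure.conv (convNPow ν n) ν))

lemma ae_nonneg_convNPow [SFinite ν] (hν : ∀ᵐ x ∂ν, 0 ≤ x) (n : ℕ) :
    ∀ᵐ x ∂(convNPow ν n), 0 ≤ x := by
  induction n with
  | zero => simp [convNPow, ae_dirac_eq]
  | succ n ih =>
    rw [convNPow, Measure.conv, ae_map_iff (by fun_prop) measurableSet_Ici]
    have h1 := Measure.quasiMeasurePreserving_fst.ae (μa := (convNPow ν n).prod ν) ih
    have h2 := Measure.quasiMeasurePreserving_snd.ae (μa := (convNPow ν n).prod ν) hν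
    filter_upwards [h1, h2] with z hz1 hz2
    exact add_nonneg hz1 hz2

lemma lintegral_exp_convNPow [SFinite ν] (lam : ℝ) (n : ℕ) :
    ∫⁻ x, ENNReal.ofReal (Real.exp (-lam * x)) ∂(convNPow ν n)
      = (∫⁻ x, ENNReal.ofReal (Real.exp (-lam * x)) ∂ν) ^ n := by
  induction n with
  | zero =>
    rw [convNPow, lintegral_dirac' _ (by fun_prop)]
    simp
  | succ n ih =>
    rw [convNPow, Measure.lintegral_conv (by fun_prop), pow_succ, ← ih,
      ← lintegral_mul_const _ (by fun_prop)]
    refine lintegral_congr fun x => ?_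
    rw [← lintegral_const_mul _ (by fun_prop)]
    refine lintegral_congr fun y => ?_
    rw [← ENNReal.ofReal_mul (by positivity), ← Real.exp_add, mul_add]

/-- The compound Poisson distribution with jump measure `κ`. -/
def compoundPoisson (κ : Measure ℝ) : Measure ℝ :=
  ENNReal.ofReal (Real.exp (-κ.real Set.univ)) •
    Measure.sum fun n : ℕ => ENNReal.ofReal ((n.factorial : ℝ)⁻¹) • convNPow κ n

lemma lintegral_exp_compoundPoisson (κ : Measure ℝ) [IsFiniteMeasure κ] {lam : ℝ}
    (hfin : Integrable (fun x => Real.exp (-lam * x)) κ) :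
    ∫⁻ x, ENNReal.ofReal (Real.exp (-lam * x)) ∂(compoundPoisson κ)
      = ENNReal.ofReal (Real.exp (-∫ x, (1 - Real.exp (-lam * x)) ∂κ)) := by
  have hl : ∫⁻ x, ENNReal.ofReal (Real.exp (-lam * x)) ∂κ
      = ENNReal.ofReal (∫ x, Real.exp (-lam * x) ∂κ) :=
    (ofReal_integral_eq_lintegral_ofReal hfin (.of_forall fun x => by positivity)).symm
  have h0 : 0 ≤ ∫ x, Real.exp (-lam * x) ∂κ := integral_nonneg fun x => by positivity
  rw [compoundPoisson, lintegral_smul_measure, lintegral_sum_measure]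
  simp_rw [lintegral_smul_measure, lintegral_exp_convNPow, hl, smul_eq_mul]
  have : ∀ n : ℕ, ENNReal.ofReal ((n.factorial : ℝ)⁻¹)
      * ENNReal.ofReal (∫ x, Real.exp (-lam * x) ∂κ) ^ n
      = ENNReal.ofReal ((∫ x, Real.exp (-lam * x) ∂κ) ^ n / n.factorial) := fun n => by
    rw [← ENNReal.ofReal_pow h0, ← ENNReal.ofReal_mul (by positivity), inv_mul_eq_div]
  simp_rw [this]
  rw [← ofReal_exp_eq_tsum h0, ← ENNReal.ofReal_mul (by positivity), ← Real.exp_add,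
    integral_sub (integrable_const _) hfin]
  congr 2
  simp only [integral_const, smul_eq_mul, mul_one]
  ring

lemma ae_nonneg_compoundPoisson {κ : Measure ℝ} [IsFiniteMeasure κ] (hκ : ∀ᵐ x ∂κ, 0 ≤ x) :
    ∀ᵐ x ∂(compoundPoisson κ), 0 ≤ x := by
  refine Measure.ae_smul_measure ?_ _
  rw [Measure.ae_sum_iff]
  exact fun n => Measure.ae_smul_measure (ae_nonneg_convNPow hκ n) _

instance isProbabilityMeasure_compoundPoisson (κ : Measure ℝ) [IsFiniteMeasure κ] :
    IsProbabilityMeasure (compoundPoisson κ) := by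
  have h := lintegral_exp_compoundPoisson κ (lam := 0) (by simp)
  exact ⟨by simpa using h⟩

end CompoundPoisson
section InfinitelyDivisible

open scoped ENNReal Topology

lemma tendsto_exp_neg_sum {a : ℕ → ℝ} (ha : ∀ k, 0 ≤ a k) {lam : ℝ} (hlam : 0 < lam) :
    Tendsto (fun N => Real.exp (-lam * ∑ k ∈ Finset.range N, a k)) atTop
      (𝓝 (if ∑' k, ENNReal.ofReal (a k) = ∞ then 0
        else Real.exp (-lam * (∑' k, ENNReal.ofReal (a k)).toReal))) := by
  split_ifs with h
  · have hns : ¬ Summable a := fun hs => by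
      rw [← ENNReal.ofReal_tsum_of_nonneg ha hs] at h
      exact ENNReal.ofReal_ne_top h
    rw [not_summable_iff_tendsto_nat_atTop_of_nonneg ha] at hns
    exact Real.tendsto_exp_atBot.comp (hns.const_mul_atTop_of_neg (neg_neg_of_pos hlam))
  · have hs : Summable a := by
      simpa [ENNReal.toReal_ofReal (ha _)] using ENNReal.summable_toReal h
    rw [← ENNReal.ofReal_tsum_of_nonneg ha hs, ENNReal.toReal_ofReal (tsum_nonneg ha)]
    exact (Real.continuous_exp.tendsto _).comp (hs.hasSum.tendsto_sum_nat.const_mul _)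

lemma integrable_one_sub_exp_neg {κ : Measure ℝ} (hκ : ∀ᵐ x ∂κ, 0 ≤ x)
    (hfin : Integrable (fun x => x) κ) {lam : ℝ} (hlam : 0 < lam) :
    Integrable (fun x => 1 - Real.exp (-lam * x)) κ := by
  refine (hfin.const_mul lam).mono' (by fun_prop) (hκ.mono fun x hx => ?_)
  have h1 : Real.exp (-lam * x) ≤ 1 := Real.exp_le_one_iff.2 (by nlinarith)
  rw [Real.norm_of_nonneg (by linarith)]
  linarith [Real.add_one_le_exp (-lam * x)]

lemma integral_one_sub_exp_neg_le {κ : Measure ℝ} (hκ : ∀ᵐ x ∂κ, 0 ≤ x)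
    (hfin : Integrable (fun x => x) κ) {lam : ℝ} (hlam : 0 < lam) :
    ∫ x, (1 - Real.exp (-lam * x)) ∂κ ≤ lam * ∫ x, x ∂κ := by
  rw [← integral_const_mul]
  refine integral_mono (integrable_one_sub_exp_neg hκ hfin hlam) (hfin.const_mul lam) fun x => ?_
  have := Real.add_one_le_exp (-lam * x)
  simp only
  linarith

lemma exists_isProbabilityMeasure_integral_exp_neg_eq (κ : Measure ℝ) [SFinite κ]
    (hκ : ∀ᵐ x ∂κ, 0 ≤ x) (hfin : Integrable (fun x => x) κ) :
    ∃ ν : Measure ℝ, IsProbabilityMeasure ν ∧ (∀ᵐ x ∂ν, 0 ≤ x) ∧ ∀ lam : ℝ, 0 < lam →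
      ∫ x, Real.exp (-lam * x) ∂ν = Real.exp (-∫ x, (1 - Real.exp (-lam * x)) ∂κ) := by
  have hκk : ∀ k, ∀ᵐ x ∂(sfiniteSeq κ k), 0 ≤ x := fun k =>
    (Measure.absolutelyContinuous_of_le (sfiniteSeq_le κ k)).ae_le hκ
  obtain ⟨Ω', _, P', W, hWm, hWlaw, hWind, _⟩ :=
    exists_hasLaw_indepFun (fun _ : ℕ => ℝ) (fun k => compoundPoisson (sfiniteSeq κ k))
  have hW0 : ∀ᵐ ω ∂P', ∀ k, 0 ≤ W k ω := by
    rw [ae_all_iff]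
    intro k
    have h := ae_nonneg_compoundPoisson (hκk k)
    rw [← (hWlaw k).map_eq] at h
    exact ae_of_ae_map (hWm k).aemeasurable h
  set S : Ω' → ℝ≥0∞ := fun ω => ∑' k, ENNReal.ofReal (W k ω) with hS
  have hSm : Measurable S := Measurable.tsum fun k => (hWm k).ennreal_ofReal
  set F : ℝ → Ω' → ℝ := fun lam ω => if S ω = ∞ then 0 else Real.exp (-lam * (S ω).toReal) with hF
  have hWlap : ∀ lam, 0 < lam → ∀ k, mgf (W k) P' (-lam)
      = Real.exp (-∫ x, (1 - Real.exp (-lam * x)) ∂(sfiniteSeq κ k)) := by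
    intro lam hlam k
    have hi : Integrable (fun x => Real.exp (-lam * x)) (sfiniteSeq κ k) :=
      Integrable.of_bound (by fun_prop) 1 ((hκk k).mono fun x hx => by
        rw [Real.norm_of_nonneg (by positivity)]
        exact Real.exp_le_one_iff.2 (by nlinarith))
    have h := lintegral_exp_compoundPoisson (sfiniteSeq κ k) hi
    rw [← mgf_id_map (hWm k).aemeasurable, (hWlaw k).map_eq, mgf]
    simp only [id]
    rw [integral_eq_lintegral_of_nonneg_ae (.of_forall fun x => by positivity) (by fun_prop), h,
      ENNReal.toReal_ofReal (by positivity)]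
  have hFint : ∀ lam, 0 < lam →
      ∫ ω, F lam ω ∂P' = Real.exp (-∫ x, (1 - Real.exp (-lam * x)) ∂κ) := by
    intro lam hlam
    have hlim : Tendsto (fun N => ∫ ω, Real.exp (-lam * ∑ k ∈ Finset.range N, W k ω) ∂P') atTop
        (𝓝 (∫ ω, F lam ω ∂P')) := by
      refine tendsto_integral_of_dominated_convergence (fun _ => 1)
        (fun N => Measurable.aestronglyMeasurable (by fun_prop)) (integrable_const _)
        (fun N => hW0.mono fun ω hω => ?_) (hW0.mono fun ω hω => tendsto_exp_neg_sum hω hlam)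
      rw [Real.norm_of_nonneg (by positivity)]
      have := Finset.sum_nonneg fun k (_ : k ∈ Finset.range N) => hω k
      exact Real.exp_le_one_iff.2 (by nlinarith)
    refine tendsto_nhds_unique hlim ?_
    have hprod : ∀ N, ∫ ω, Real.exp (-lam * ∑ k ∈ Finset.range N, W k ω) ∂P'
        = Real.exp (-∑ k ∈ Finset.range N,
          ∫ x, (1 - Real.exp (-lam * x)) ∂(sfiniteSeq κ k)) := fun N => by
      have h := hWind.mgf_sum (t := -lam) hWm (Finset.range N)
      simp_rw [hWlap lam hlam] at h
      rw [← Real.exp_sum, Finset.sum_neg_distrib] at h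
      rw [← h, mgf]
      simp [Finset.sum_apply]
    simp_rw [hprod]
    have hi := integrable_one_sub_exp_neg hκ hfin hlam
    rw [← sum_sfiniteSeq κ] at hi
    have hs := hasSum_integral_measure hi
    rw [sum_sfiniteSeq κ] at hs
    exact (Real.continuous_exp.tendsto _).comp hs.tendsto_sum_nat.neg
  have hSfin : ∀ᵐ ω ∂P', S ω ≠ ∞ := by
    have hms : MeasurableSet {ω | S ω ≠ ∞} := (hSm (measurableSet_singleton _)).compl
    have hle : ∀ lam, 0 < lam → Real.exp (-(lam * ∫ x, x ∂κ)) ≤ P'.real {ω | S ω ≠ ∞} := by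
      intro lam hlam
      refine (Real.exp_le_exp.2 (neg_le_neg (integral_one_sub_exp_neg_le hκ hfin hlam))).trans ?_
      rw [← hFint lam hlam, ← integral_indicator_one hms]
      have hle' : ∀ ω, F lam ω ≤ {ω | S ω ≠ ∞}.indicator 1 ω := fun ω => by
        by_cases h : S ω = ∞
        · simp [hF, h]
        · simp only [hF, h, if_false, Set.indicator, Set.mem_ofPred_eq, ne_eq, not_false_iff, if_true,
            Pi.one_apply]
          exact Real.exp_le_one_iff.2 (by nlinarith [(S ω).toReal_nonneg])
      refine integral_mono_of_nonneg (.of_forall fun ω => ?_)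
        ((integrable_const (1 : ℝ)).indicator hms) (.of_forall hle')
      simp only [hF]
      split_ifs <;> positivity
    have hone : 1 ≤ P'.real {ω | S ω ≠ ∞} := by
      have ht : Tendsto (fun lam : ℝ => Real.exp (-(lam * ∫ x, x ∂κ))) (𝓝[>] 0) (𝓝 1) := by
        have : Continuous fun lam : ℝ => Real.exp (-(lam * ∫ x, x ∂κ)) := by fun_prop
        simpa using (this.tendsto 0).mono_left nhdsWithin_le_nhds
      exact le_of_tendsto ht (eventually_nhdsWithin_of_forall hle)
    have heq : P'.real {ω | S ω ≠ ∞} = 1 := le_antisymm measureReal_le_one hone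
    rw [measureReal_def, ENNReal.toReal_eq_one_iff] at heq
    exact (mem_ae_iff_prob_eq_one hms).2 heq
  have hSr : Measurable fun ω => (S ω).toReal := hSm.ennreal_toReal
  refine ⟨P'.map fun ω => (S ω).toReal, Measure.isProbabilityMeasure_map hSr.aemeasurable, ?_,
    fun lam hlam => ?_⟩
  · rw [ae_map_iff hSr.aemeasurable measurableSet_Ici]
    exact .of_forall fun ω => ENNReal.toReal_nonneg
  · rw [integral_map hSr.aemeasurable (by fun_prop), ← hFint lam hlam]
    refine integral_congr_ae (hSfin.mono fun ω hω => ?_)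
    simp [hF, hω]

lemma exists_convolution_root_measure {p : ℝ → ℝ} (hp : Measurable p) (hp0 : ∀ t, 0 ≤ p t)
    (hp1 : ∀ t, p t ≤ 1) {q c : ℝ} (hq : 0 < q) (hc : 0 ≤ c) :
    ∃ ν : Measure ℝ, IsProbabilityMeasure ν ∧ (∀ᵐ x ∂ν, 0 ≤ x) ∧ ∀ lam : ℝ, 0 < lam →
      ∫ x, Real.exp (-lam * x) ∂ν = Real.exp (-c * ∫ t in Set.Ioi (0 : ℝ),
        Real.exp (-q * t) * t⁻¹ * p t * (1 - Real.exp (-lam * t))) := by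
  set d : ℝ → ℝ≥0∞ := fun t => ENNReal.ofReal (c * (Real.exp (-q * t) * t⁻¹ * p t)) with hd
  have hdm : Measurable d := by fun_prop
  have hpos : ∀ᵐ t ∂(volume.restrict (Set.Ioi (0 : ℝ))), 0 < t := ae_restrict_mem measurableSet_Ioi
  have hdt : ∀ t, 0 < t → (d t).toReal = c * (Real.exp (-q * t) * t⁻¹ * p t) := fun t ht =>
    ENNReal.toReal_ofReal (mul_nonneg hc (mul_nonneg (by positivity) (hp0 t)))
  have hlt : ∀ᵐ t ∂(volume.restrict (Set.Ioi (0 : ℝ))), d t < ∞ :=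
    .of_forall fun t => ENNReal.ofReal_lt_top
  obtain ⟨ν, hν, hν0, hνl⟩ := exists_isProbabilityMeasure_integral_exp_neg_eq
    ((volume.restrict (Set.Ioi (0 : ℝ))).withDensity d)
    ((withDensity_absolutelyContinuous _ _).ae_le (hpos.mono fun t ht => ht.le)) (by
      rw [integrable_withDensity_iff hdm hlt]
      refine ((exp_neg_integrableOn_Ioi 0 hq).const_mul c).mono' (by fun_prop)
        (hpos.mono fun t ht => ?_)
      rw [hdt t ht, Real.norm_of_nonneg
        (mul_nonneg ht.le (mul_nonneg hc (mul_nonneg (by positivity) (hp0 t))))]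
      calc t * (c * (Real.exp (-q * t) * t⁻¹ * p t)) = c * Real.exp (-q * t) * p t := by
            field_simp
        _ ≤ c * Real.exp (-q * t) := mul_le_of_le_one_right (by positivity) (hp1 t))
  refine ⟨ν, hν, hν0, fun lam hlam => ?_⟩
  rw [hνl lam hlam, integral_withDensity_eq_integral_toReal_smul hdm hlt, neg_mul,
    ← integral_const_mul]
  congr 2
  refine integral_congr_ae (hpos.mono fun t ht => ?_)
  simp only [hdt t ht, smul_eq_mul]
  ring

lemma integral_exp_convNPow {ν : Measure ℝ} [IsProbabilityMeasure ν] (lam : ℝ) (n : ℕ) :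
    ∫ x, Real.exp (-lam * x) ∂(convNPow ν n) = (∫ x, Real.exp (-lam * x) ∂ν) ^ n := by
  rw [integral_eq_lintegral_of_nonneg_ae (.of_forall fun x => by positivity) (by fun_prop),
    integral_eq_lintegral_of_nonneg_ae (.of_forall fun x => by positivity) (by fun_prop),
    lintegral_exp_convNPow, ENNReal.toReal_pow]

lemma ae_nonneg_of_map_eq_expMeasure {P : Measure Ω} {E : Ω → ℝ} {q : ℝ} (hE : Measurable E)
    (hEdist : P.map E = expMeasure q) : ∀ᵐ ω ∂P, 0 ≤ E ω := by
  have h : ∀ᵐ x ∂(expMeasure q), 0 ≤ x := by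
    have hm : MeasurableSet {x : ℝ | ¬ 0 ≤ x} :=
      (measurableSet_le measurable_const measurable_id).compl
    rw [ae_iff, ← lintegral_indicator_one hm, lintegral_expMeasure _ (measurable_one.indicator hm),
      setLIntegral_congr_fun (g := fun _ => 0) measurableSet_Ioi, lintegral_zero]
    intro t ht
    have ht : 0 < t := ht
    simp [ht.le]
  rw [← hEdist] at h
  exact ae_of_ae_map hE.aemeasurable h

end InfinitelyDivisible

/-- **Laplace transform and infinite divisibility of `A_E`.** If `E ~ Exp(q)` is
independent of the Lévy process `X`, then for all `λ > 0`,
`E[e^{-λ A_E}] = exp(-∫_0^∞ e^{-qt} t⁻¹ P(X_t > 0)(1 - e^{-λt}) dt)`; in particular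
`A_E` is infinitely divisible, and its `n`-th convolution root has the Lévy–Khintchine
exponent given by `(1/n)` times the Lévy measure `e^{-qt} t⁻¹ P(X_t > 0) dt` on `(0,∞)`. -/
theorem sojourn_exponential_laplace_infdiv (P : Measure Ω) [IsProbabilityMeasure P]
    (X : ℝ → Ω → ℝ) (hX : IsLevyProcess P X) (q : ℝ) (hq : 0 < q)
    (E : Ω → ℝ) (hE : Measurable E) (hEdist : P.map E = expMeasure q)
    (hEX : IndepFun E (fun ω (s : ℝ) => X s ω) P) :
    (∀ lam : ℝ, 0 < lam →
      ∫ ω, Real.exp (-lam * sojourn X (E ω) ω) ∂P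
        = Real.exp (- ∫ t in Set.Ioi (0:ℝ),
            Real.exp (-q * t) * t⁻¹ * (P {ω | 0 < X t ω}).toReal * (1 - Real.exp (-lam * t)))) ∧
    (∀ n : ℕ, 0 < n → ∃ ν : Measure ℝ, IsProbabilityMeasure ν ∧
      P.map (fun ω => sojourn X (E ω) ω) = convNPow ν n ∧
      ∀ lam : ℝ, 0 < lam →
        ∫ x, Real.exp (-lam * x) ∂ν
          = Real.exp (-(1 / (n : ℝ)) * ∫ t in Set.Ioi (0:ℝ),
              Real.exp (-q * t) * t⁻¹ * (P {ω | 0 < X t ω}).toReal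
                * (1 - Real.exp (-lam * t)))) := by
  obtain ⟨Y, hY, hL, hYX⟩ := hX.exists_measurable_modification
  have hae : ∀ t, 0 ≤ t → X t =ᵐ[P] Y t := fun t ht =>
    hYX.mono fun ω h => (h t ht).symm
  have hE0 := ae_nonneg_of_map_eq_expMeasure hE hEdist
  have hind : ∀ (k : ℕ) (v : Fin k → ℝ), (∀ i, 0 < v i) →
      IndepFun (fun ω i => Y (v i) ω) E P := fun k v hv => by
    have h : Measurable fun (x : ℝ → ℝ) (i : Fin k) => x (v i) := by fun_prop
    refine (hEX.comp measurable_id h).symm.congr (hYX.mono fun ω hω => ?_) (ae_eq_refl E)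
    funext i
    exact (hω _ (hv i).le).symm
  have hsoj : (fun ω => sojourn Y (E ω) ω) =ᵐ[P] fun ω => sojourn X (E ω) ω := by
    filter_upwards [hYX, hE0] with ω h h0 using sojourn_congr h h0
  have hAY : AEMeasurable (fun ω => sojourn Y (E ω) ω) P :=
    (measurable_sojourn hY hE).aemeasurable.congr (hE0.mono fun ω h => by simp only [max_eq_left h])
  have hA : AEMeasurable (fun ω => sojourn X (E ω) ω) P := hAY.congr hsoj
  have hpY : ∀ t ∈ Set.Ioi (0 : ℝ), P.real {ω | 0 < Y t ω} = (P {ω | 0 < X t ω}).toReal :=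
    fun t ht => congrArg ENNReal.toReal (measure_congr (eventuallyEq_set.2
      ((hae t (le_of_lt ht)).mono fun ω h => by simp [h])))
  have hI : ∀ lam : ℝ, ∫ t in Set.Ioi (0 : ℝ), Real.exp (-q * t) * t⁻¹ * P.real {ω | 0 < Y t ω}
        * (1 - Real.exp (-lam * t))
      = ∫ t in Set.Ioi (0 : ℝ), Real.exp (-q * t) * t⁻¹ * (P {ω | 0 < X t ω}).toReal
        * (1 - Real.exp (-lam * t)) := fun lam =>
    setIntegral_congr_fun measurableSet_Ioi fun t ht => by simp only [hpY t ht]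
  have hlap : ∀ lam : ℝ, 0 < lam → ∫ ω, Real.exp (-lam * sojourn X (E ω) ω) ∂P
        = Real.exp (- ∫ t in Set.Ioi (0:ℝ),
            Real.exp (-q * t) * t⁻¹ * (P {ω | 0 < X t ω}).toReal
              * (1 - Real.exp (-lam * t))) := fun lam hlam => by
    rw [← hI, ← integral_exp_sojourn hY hL hq hlam hE hEdist hind hE0 hAY]
    exact integral_congr_ae (hsoj.mono fun ω h => by simp only [h])
  refine ⟨hlap, fun n hn => ?_⟩
  have hmeas : Measurable fun t => P.real {ω | 0 < Y t ω} := by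
    have hm : MeasurableSet {z : ℝ × Ω | 0 < Y z.1 z.2} := measurableSet_lt measurable_const hY
    exact (measurable_measure_prodMk_left hm).ennreal_toReal
  obtain ⟨ν, hν, hν0, hνl⟩ := exists_convolution_root_measure hmeas (fun t => measureReal_nonneg)
    (fun t => measureReal_le_one) hq (c := 1 / (n : ℝ)) (by positivity)
  simp_rw [hI] at hνl
  refine ⟨ν, hν, ?_, hνl⟩
  have := Measure.isProbabilityMeasure_map hA
  refine Measure.ext_of_forall_integral_exp_neg_eq ?_ (ae_nonneg_convNPow hν0 n) fun lam hlam => ?_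
  · rw [ae_map_iff hA measurableSet_Ici]
    exact hE0.mono fun ω h => sojourn_nonneg X h ω
  · rw [integral_map hA (by fun_prop), hlap lam hlam, integral_exp_convNPow, hνl lam hlam,
      ← Real.exp_nat_mul]
    have hn0 : (n : ℝ) ≠ 0 := by exact_mod_cast hn.ne'
    rw [← mul_assoc, mul_neg, mul_one_div_cancel hn0, neg_one_mul]

end
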